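/- Let q be a prime power with q ≡ 7 (mod 8), let k be an algebraically closed field of characteristic 2, and let G = PSL_2(q) be the quotient of SL_2(q) by its center. Then there exists a simple kG-module of dimension (q−1)/2, and every simple kG-module of dimension (q−1)/2 is non-algebraic. -/

import Mathlib

open CategoryTheory CategoryTheory.MonoidalCategory

namespace AlgebraicModule

variable {k G : Type} [Field k] [Monoid G]

/-- `N` is a direct summand of `M`, i.e. a retract of `M`. -/
def IsSummand (N M : FDRep k G) : Prop :=
  ∃ (i : N ⟶ M) (r : M ⟶ N), i ≫ r = 𝟙 N

/-- `M` is an indecomposable module: it is nonzero and is not the direct sum of two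
nonzero submodules (equivalently, its only idempotent endomorphisms are `0` and `1`). -/
def Indecomposable (M : FDRep k G) : Prop :=
  ¬ Limits.IsZero M ∧ ∀ e : M ⟶ M, e ≫ e = e → e = 0 ∨ e = 𝟙 M

/-- `tensorPow M n` is the tensor power `M^{⊗ (n + 1)}`, with diagonal `G`-action. -/
noncomputable def tensorPow (M : FDRep k G) : ℕ → FDRep k G
  | 0 => M
  | n + 1 => tensorPow M n ⊗ M

/-- `M` is algebraic: only finitely many isomorphism classes of indecomposable modules
occur as direct summands of the tensor powers `M^{⊗ n}` for `n ≥ 1`. -/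
noncomputable def IsAlgebraic (M : FDRep k G) : Prop :=
  ∃ L : List (FDRep k G), ∀ N : FDRep k G, Indecomposable N →
    (∃ n : ℕ, IsSummand N (tensorPow M n)) → ∃ N' ∈ L, Nonempty (N ≅ N')

end AlgebraicModule

open AlgebraicModule

/-- `PSL_n(F)`: the quotient of `SL_n(F)` by its center. -/
abbrev PSL (n : ℕ) (F : Type) [Field F] : Type :=
  Matrix.SpecialLinearGroup (Fin n) F ⧸ Subgroup.center (Matrix.SpecialLinearGroup (Fin n) F)



namespace PSLNA

open Module

/-- A pair of commuting involutions, i.e. a module for the Klein four group. -/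
structure V4 (k X : Type*) [Field k] [AddCommGroup X] [Module k X] where
  a : X →ₗ[k] X
  b : X →ₗ[k] X
  haa : ∀ x, a (a x) = x
  hbb : ∀ x, b (b x) = x
  hba : ∀ x, b (a x) = a (b x)

variable {k X Y Z : Type*} [Field k] [AddCommGroup X] [Module k X]
  [AddCommGroup Y] [Module k Y] [AddCommGroup Z] [Module k Z]

namespace V4

attribute [simp] haa hbb hba

/-- relative trace -/
def tr (P : V4 k X) (Q : V4 k Y) (f : X →ₗ[k] Y) : X →ₗ[k] Y :=
  f + Q.a ∘ₗ f ∘ₗ P.a + Q.b ∘ₗ f ∘ₗ P.b + Q.a ∘ₗ Q.b ∘ₗ f ∘ₗ P.a ∘ₗ P.b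

lemma tr_apply (P : V4 k X) (Q : V4 k Y) (f : X →ₗ[k] Y) (x : X) :
    tr P Q f x = f x + Q.a (f (P.a x)) + Q.b (f (P.b x)) + Q.a (Q.b (f (P.a (P.b x)))) := rfl

/-- the norm element -/
def s (P : V4 k X) : X →ₗ[k] X := LinearMap.id + P.a + P.b + P.a ∘ₗ P.b

lemma s_apply (P : V4 k X) (x : X) : P.s x = x + P.a x + P.b x + P.a (P.b x) := rfl

/-- equivariant maps -/
def Eqv (P : V4 k X) (Q : V4 k Y) (f : X →ₗ[k] Y) : Prop :=
  (∀ x, f (P.a x) = Q.a (f x)) ∧ (∀ x, f (P.b x) = Q.b (f x))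

def Hig (P : V4 k X) : Prop := ∃ h : X →ₗ[k] X, tr P P h = LinearMap.id

lemma tr_eqv (P : V4 k X) (Q : V4 k Y) (f : X →ₗ[k] Y) : Eqv P Q (tr P Q f) := by
  constructor <;> intro x <;> simp [tr_apply] <;> abel

lemma comp_tr {P : V4 k X} {Q : V4 k Y} {R : V4 k Z} (f : X →ₗ[k] Y) {g : Y →ₗ[k] Z}
    (hg : Eqv Q R g) : g ∘ₗ tr P Q f = tr P R (g ∘ₗ f) := by
  ext x; simp [tr_apply, hg.1, hg.2]

lemma tr_comp {P : V4 k X} {Q : V4 k Y} {R : V4 k Z} {f : X →ₗ[k] Y} (g : Y →ₗ[k] Z)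
    (hf : Eqv P Q f) : tr Q R g ∘ₗ f = tr P R (g ∘ₗ f) := by
  ext x; simp [tr_apply, hf.1, hf.2]

lemma tr_add (P : V4 k X) (Q : V4 k Y) (f g : X →ₗ[k] Y) : tr P Q (f + g) = tr P Q f + tr P Q g := by
  ext x; simp [tr_apply]; abel

lemma tr_smul (P : V4 k X) (Q : V4 k Y) (c : k) (f : X →ₗ[k] Y) :
    tr P Q (c • f) = c • tr P Q f := by
  ext x; simp [tr_apply]

/-- stable endomorphism ring is `k` -/
def StEnd (P : V4 k X) : Prop :=
  ∀ φ : X →ₗ[k] X, Eqv P P φ → ∃ (c : k) (f : X →ₗ[k] X), φ = c • LinearMap.id + tr P P f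

/-- short exact sequences with free middle term -/
structure Seq (PK : V4 k X) (PP : V4 k Y) (PX : V4 k Z) : Type _ where
  i : X →ₗ[k] Y
  p : Y →ₗ[k] Z
  hi : Function.Injective i
  hp : Function.Surjective p
  ex : LinearMap.range i = LinearMap.ker p
  ei : Eqv PK PP i
  ep : Eqv PP PX p

lemma Seq.stEnd {PK : V4 k X} {PP : V4 k Y} {PX : V4 k Z} (S : Seq PK PP PX) (hP : PP.Hig)
    (hX : PX.StEnd) : PK.StEnd := by
  obtain ⟨h, hh⟩ := hP
  intro φ hφ
  obtain ⟨r, hr⟩ := S.i.exists_leftInverse_of_injective (LinearMap.ker_eq_bot.2 S.hi)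
  obtain ⟨t, ht⟩ := S.p.exists_rightInverse_of_surjective (LinearMap.range_eq_top.2 S.hp)
  have pi0 : ∀ x, S.p (S.i x) = 0 := fun x => by
    have : S.i x ∈ LinearMap.ker S.p := S.ex ▸ LinearMap.mem_range_self _ _
    simpa using this
  have hr' : ∀ x, r (S.i x) = x := fun x => congrArg (fun f => f x) hr
  have ht' : ∀ x, S.p (t x) = x := fun x => congrArg (fun f => f x) ht
  set Φ := tr PP PP (h ∘ₗ S.i ∘ₗ φ ∘ₗ r) with hΦ
  have hΦe : Eqv PP PP Φ := tr_eqv _ _ _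
  have hΦi : ∀ x, Φ (S.i x) = S.i (φ x) := by
    intro x
    have := congrArg (fun f => f (S.i (φ x))) hh
    simp only [tr_apply, LinearMap.id_apply] at this
    rw [← this]
    simp [hΦ, tr_apply, ← S.ei.1, ← S.ei.2, hr', hφ.1, hφ.2]
  have key : ∀ y, S.p y = 0 → ∃ x, S.i x = y := fun y hy => by
    have : y ∈ LinearMap.range S.i := by rw [S.ex]; exact hy
    exact this
  -- induced map
  set Ψ : Z →ₗ[k] Z := S.p ∘ₗ Φ ∘ₗ t with hΨ
  have hΨp : ∀ y, Ψ (S.p y) = S.p (Φ y) := by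
    intro y
    obtain ⟨x, hx⟩ := key (t (S.p y) - y) (by simp [ht'])
    have : t (S.p y) = y + S.i x := by rw [hx]; abel
    simp [hΨ, this, hΦi, pi0]
  have hΨe : Eqv PX PX Ψ := by
    constructor <;> intro z <;> obtain ⟨y, rfl⟩ := S.hp z
    · rw [← S.ep.1, hΨp, hΦe.1, S.ep.1, hΨp]
    · rw [← S.ep.2, hΨp, hΦe.2, S.ep.2, hΨp]
  obtain ⟨c, f, hf⟩ := hX Ψ hΨe
  set ft := tr PP PP (t ∘ₗ f ∘ₗ S.p) with hft
  have hfte : Eqv PP PP ft := tr_eqv _ _ _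
  have hd : ∀ y, S.p (Φ y - c • y - ft y) = 0 := by
    intro y
    rw [map_sub, map_sub, ← hΨp, hf]
    simp [hft, tr_apply, S.ep.1, S.ep.2, ht']
  set D : Y →ₗ[k] Y := Φ - c • LinearMap.id - ft with hD
  have hDe : Eqv PP PP D := by
    constructor <;> intro y <;> simp [hD, hΦe.1, hΦe.2, hfte.1, hfte.2]
  set g : Y →ₗ[k] X := r ∘ₗ D with hg
  have hgi : ∀ y, S.i (g y) = D y := by
    intro y
    obtain ⟨x, hx⟩ := key (D y) (hd y)
    simp [hg, ← hx, hr']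
  have hge : Eqv PP PK g := by
    constructor <;> intro y <;> apply S.hi
    · rw [hgi, S.ei.1, hgi, hDe.1]
    · rw [hgi, S.ei.2, hgi, hDe.2]
  refine ⟨c, g ∘ₗ h ∘ₗ S.i, ?_⟩
  ext x
  apply S.hi
  have h1 : tr PK PK (g ∘ₗ h ∘ₗ S.i) = g ∘ₗ S.i := by
    rw [← LinearMap.comp_assoc, ← tr_comp _ S.ei, ← comp_tr _ hge, hh, LinearMap.comp_id]
  rw [h1]
  have h2 : ft (S.i x) = 0 := by
    simp [hft, tr_apply, ← S.ei.1, ← S.ei.2, pi0]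
  simp [hgi, hD, h2, hΦi]

/-- augmentation submodule `I X` -/
def aug (P : V4 k X) : Submodule k X :=
  LinearMap.range (LinearMap.id + P.a) ⊔ LinearMap.range (LinearMap.id + P.b)

/-- fixed points -/
def fix (P : V4 k X) : Submodule k X :=
  LinearMap.ker (P.a - LinearMap.id) ⊓ LinearMap.ker (P.b - LinearMap.id)

lemma mem_fix {P : V4 k X} {x : X} : x ∈ P.fix ↔ P.a x = x ∧ P.b x = x := by
  simp [fix, sub_eq_zero]

lemma s_mem_fix (P : V4 k X) (x : X) : P.s x ∈ P.fix := by
  rw [mem_fix]; constructor <;> simp [s_apply] <;> abel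

lemma a_sub_mem_aug [CharP k 2] (P : V4 k X) (x : X) : P.a x + x ∈ P.aug :=
  Submodule.mem_sup_left ⟨x, by simp [add_comm]⟩

lemma b_sub_mem_aug [CharP k 2] (P : V4 k X) (x : X) : P.b x + x ∈ P.aug :=
  Submodule.mem_sup_right ⟨x, by simp [add_comm]⟩

lemma add_self2 [CharP k 2] (x : X) : x + x = 0 := by
  rw [← two_smul k x, CharTwo.two_eq_zero, zero_smul]

lemma Hig.fix_le {P : V4 k X} (hP : P.Hig) : P.fix ≤ LinearMap.range P.s := by
  obtain ⟨h, hh⟩ := hP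
  intro x hx
  rw [mem_fix] at hx
  have := congrArg (fun f => f x) hh
  simp only [tr_apply, LinearMap.id_apply, hx.1, hx.2] at this
  exact ⟨h x, this⟩

lemma range_s_le_fix (P : V4 k X) : LinearMap.range P.s ≤ P.fix := by
  rintro _ ⟨x, rfl⟩; exact s_mem_fix P x

lemma Hig.ker_le [CharP k 2] {P : V4 k X} (hP : P.Hig) : LinearMap.ker P.s ≤ P.aug := by
  obtain ⟨h, hh⟩ := hP
  intro x hx
  have h0 : x + P.a x + P.b x + P.a (P.b x) = 0 := hx
  have h1 := congrArg (fun f => f x) hh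
  simp only [tr_apply, LinearMap.id_apply] at h1
  have h2 := congrArg h h0
  simp only [map_add, map_zero] at h2
  set y1 := h (P.a x)
  set y2 := h (P.b x)
  set y3 := h (P.a (P.b x))
  have : x = (P.a y1 + y1) + (P.b y2 + y2) + ((P.a (P.b y3) + P.b y3) + (P.b y3 + y3)) := by
    rw [← h1]
    have e1 := add_self2 (k := k) y1
    have e2 := add_self2 (k := k) y2
    have e3 := add_self2 (k := k) y3
    have e4 := add_self2 (k := k) (P.b y3)
    have : h x = -(y1 + y2 + y3) := by
      rw [eq_neg_iff_add_eq_zero, ← h2]; abel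
    rw [this, neg_eq_of_add_eq_zero_left (add_self2 (k := k) _)]
    have : P.a y1 + y1 + (P.b y2 + y2) + (P.a (P.b y3) + P.b y3 + (P.b y3 + y3))
      = y1 + y2 + y3 + P.a y1 + P.b y2 + P.a (P.b y3) + (P.b y3 + P.b y3) := by abel
    rw [this, e4, add_zero]
  rw [this]
  exact add_mem (add_mem (a_sub_mem_aug P _) (b_sub_mem_aug P _))
    (add_mem (a_sub_mem_aug P _) (b_sub_mem_aug P _))

lemma aug_le_ker [CharP k 2] (P : V4 k X) : P.aug ≤ LinearMap.ker P.s := by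
  refine sup_le ?_ ?_
  · rintro _ ⟨x, rfl⟩
    have := add_self2 (k := k) (x + P.a x + P.b x + P.a (P.b x))
    simp [s_apply]
    rw [← this]; abel
  · rintro _ ⟨x, rfl⟩
    have := add_self2 (k := k) (x + P.a x + P.b x + P.a (P.b x))
    simp [s_apply]
    rw [← this]; abel

end V4
end PSLNA


namespace PSLNA

open Module

variable {k X Y Z : Type*} [Field k] [AddCommGroup X] [Module k X]
  [AddCommGroup Y] [Module k Y] [AddCommGroup Z] [Module k Z]

lemma finrank_map_inf [FiniteDimensional k X] (f : X →ₗ[k] Y) (p : Submodule k X) :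
    finrank k (p.map f) + finrank k (p ⊓ LinearMap.ker f : Submodule k X) = finrank k p := by
  have h := LinearMap.finrank_range_add_finrank_ker (f.domRestrict p)
  rw [LinearMap.range_domRestrict] at h
  have : finrank k (LinearMap.ker (f.domRestrict p)) =
      finrank k (p ⊓ LinearMap.ker f : Submodule k X) := by
    rw [LinearMap.ker_domRestrict, LinearEquiv.finrank_eq
      (Submodule.equivMapOfInjective p.subtype p.injective_subtype _),
      Submodule.map_comap_eq, Submodule.range_subtype]
  omega

lemma finrank_map_inj (f : X →ₗ[k] Y) (hf : Function.Injective f) (p : Submodule k X) :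
    finrank k (p.map f) = finrank k p :=
  (LinearEquiv.finrank_eq (Submodule.equivMapOfInjective f hf p)).symm

namespace V4

/-- `1 + a` -/
def A1 (P : V4 k X) : X →ₗ[k] X := LinearMap.id + P.a
/-- `1 + b` -/
def B1 (P : V4 k X) : X →ₗ[k] X := LinearMap.id + P.b

lemma A1_apply (P : V4 k X) (x : X) : P.A1 x = x + P.a x := rfl
lemma B1_apply (P : V4 k X) (x : X) : P.B1 x = x + P.b x := rfl

lemma add_eq_zero2 [CharP k 2] {x y : X} : x + y = 0 ↔ y = x := by
  constructor
  · intro h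
    have h2 := add_self2 (k := k) x
    exact add_left_cancel (h.trans h2.symm)
  · rintro rfl; exact add_self2 (k := k) _

lemma mem_kerA [CharP k 2] {P : V4 k X} {x : X} : x ∈ LinearMap.ker P.A1 ↔ P.a x = x := by
  rw [LinearMap.mem_ker, A1_apply, add_eq_zero2 (k := k)]

lemma mem_kerB [CharP k 2] {P : V4 k X} {x : X} : x ∈ LinearMap.ker P.B1 ↔ P.b x = x := by
  rw [LinearMap.mem_ker, B1_apply, add_eq_zero2 (k := k)]

lemma rangeA_le [CharP k 2] (P : V4 k X) : LinearMap.range P.A1 ≤ LinearMap.ker P.A1 := by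
  rintro _ ⟨x, rfl⟩
  rw [mem_kerA, A1_apply]; simp [add_comm]

lemma fix_eq [CharP k 2] (P : V4 k X) : P.fix = LinearMap.ker P.A1 ⊓ LinearMap.ker P.B1 := by
  ext x; rw [mem_fix, Submodule.mem_inf, mem_kerA, mem_kerB]

lemma map_range (P : V4 k X) : (LinearMap.range P.A1).map P.B1 = LinearMap.range P.s := by
  rw [← LinearMap.range_comp]
  congr 1
  ext x; simp [A1_apply, B1_apply, s_apply]; abel

lemma map_range_le [CharP k 2] (P : V4 k X) :
    (LinearMap.range P.A1).map P.B1 ≤ LinearMap.range P.A1 ⊓ LinearMap.ker P.B1 := by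
  rintro _ ⟨_, ⟨x, rfl⟩, rfl⟩
  refine ⟨⟨x + P.b x, ?_⟩, ?_⟩
  · simp [A1_apply, B1_apply]; abel
  · rw [SetLike.mem_coe, mem_kerB]; simp [A1_apply, B1_apply]; abel

lemma four_le [CharP k 2] [FiniteDimensional k X] (P : V4 k X) :
    2 * finrank k (LinearMap.range P.s) ≤ finrank k (LinearMap.range P.A1) ∧
    2 * finrank k (LinearMap.range P.A1) ≤ finrank k X := by
  have h1 := finrank_map_inf P.B1 (LinearMap.range P.A1)
  have h2 := Submodule.finrank_mono (map_range_le P)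
  have h3 := LinearMap.finrank_range_add_finrank_ker P.A1
  have h4 := Submodule.finrank_mono (rangeA_le P)
  rw [map_range] at h1 h2
  omega

lemma Hig.kerA_le [CharP k 2] {P : V4 k X} (hP : P.Hig) :
    LinearMap.ker P.A1 ≤ LinearMap.range P.A1 := by
  obtain ⟨h, hh⟩ := hP
  intro x hx
  rw [mem_kerA] at hx
  have := congrArg (fun f => f x) hh
  simp only [tr_apply, LinearMap.id_apply, hx, ← P.hba] at this
  refine ⟨h x + P.b (h (P.b x)), ?_⟩
  conv_rhs => rw [← this]
  simp [A1_apply]; abel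

lemma Hig.finrank_eq [CharP k 2] [FiniteDimensional k X] {P : V4 k X} (hP : P.Hig) :
    4 * finrank k (LinearMap.range P.s) = finrank k X := by
  have e1 : LinearMap.ker P.A1 = LinearMap.range P.A1 := le_antisymm hP.kerA_le (rangeA_le P)
  have e2 : P.fix = LinearMap.range P.s := le_antisymm hP.fix_le (range_s_le_fix P)
  have h1 := finrank_map_inf P.B1 (LinearMap.range P.A1)
  have h3 := LinearMap.finrank_range_add_finrank_ker P.A1
  rw [map_range, ← e1, ← fix_eq, e2] at h1
  rw [e1] at h1 h3
  omega

lemma exists_fix [CharP k 2] (P : V4 k X) (N : Submodule k X) (ha : ∀ x ∈ N, P.a x ∈ N)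
    (hb : ∀ x ∈ N, P.b x ∈ N) (x : X) (hx : x ∈ N) (h0 : x ≠ 0) : ∃ y ∈ N, y ≠ 0 ∧ y ∈ P.fix := by
  obtain ⟨y, hy, hy0, hya⟩ : ∃ y ∈ N, y ≠ 0 ∧ P.a y = y := by
    by_cases h : x + P.a x = 0
    · exact ⟨x, hx, h0, (add_eq_zero2 (k := k)).1 h⟩
    · exact ⟨_, add_mem hx (ha x hx), h, by simp [add_comm]⟩
  by_cases h : y + P.b y = 0
  · exact ⟨y, hy, hy0, mem_fix.2 ⟨hya, (add_eq_zero2 (k := k)).1 h⟩⟩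
  · refine ⟨_, add_mem hy (hb y hy), h, mem_fix.2 ⟨?_, by simp [add_comm]⟩⟩
    rw [map_add, ← P.hba, hya]

lemma hig_of_finrank [CharP k 2] [FiniteDimensional k X] (P : V4 k X)
    (hr : finrank k X ≤ 4 * finrank k (LinearMap.range P.s)) : P.Hig := by
  have hfix : P.fix = LinearMap.range P.s := by
    have h1 := finrank_map_inf P.B1 (LinearMap.range P.A1)
    have h3 := LinearMap.finrank_range_add_finrank_ker P.A1
    have h5 := four_le P
    have e1 : LinearMap.range P.A1 = LinearMap.ker P.A1 :=
      Submodule.eq_of_le_of_finrank_le (rangeA_le P) (by omega)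
    rw [map_range, e1, ← fix_eq, ← e1] at h1
    exact (Submodule.eq_of_le_of_finrank_le (range_s_le_fix P) (by omega)).symm
  obtain ⟨t0, ht0⟩ := P.s.rangeRestrict.exists_rightInverse_of_surjective
    (LinearMap.range_rangeRestrict _)
  obtain ⟨t, ht⟩ := LinearMap.exists_extend t0
  have hst : ∀ z ∈ P.fix, P.s (t z) = z := by
    intro z hz
    rw [hfix] at hz
    have h1 := congrArg (fun f => f ⟨z, hz⟩) ht
    have h2 := congrArg (fun f => (f ⟨z, hz⟩ : LinearMap.range P.s).1) ht0
    simp at h1 h2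
    rw [h1]; exact h2
  set θ := tr P P t with hθ
  have hθe : Eqv P P θ := tr_eqv _ _ _
  have hθf : ∀ z ∈ P.fix, θ z = z := by
    intro z hz
    have := mem_fix.1 hz
    conv_rhs => rw [← hst z hz]
    simp [hθ, tr_apply, s_apply, this.1, this.2]
  have hinj : Function.Injective θ := by
    rw [← LinearMap.ker_eq_bot]
    by_contra hne
    obtain ⟨x, hx, hx0⟩ := Submodule.exists_mem_ne_zero_of_ne_bot hne
    obtain ⟨y, hy, hy0, hyf⟩ := exists_fix P (LinearMap.ker θ)
      (fun x hx => by simp [LinearMap.mem_ker, hθe.1, LinearMap.mem_ker.1 hx])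
      (fun x hx => by simp [LinearMap.mem_ker, hθe.2, LinearMap.mem_ker.1 hx]) x hx hx0
    apply hy0
    rw [← hθf y hyf]; exact hy
  set e := LinearEquiv.ofInjectiveEndo θ hinj with he
  have hee : ∀ x, θ (e.symm x) = x := fun x => by
    have := e.apply_symm_apply x
    exact this
  have hes : Eqv P P e.symm.toLinearMap := by
    constructor <;> intro x <;> apply hinj <;> simp [hθe.1, hθe.2, hee]
  refine ⟨t ∘ₗ e.symm.toLinearMap, ?_⟩
  rw [← tr_comp _ hes]
  ext x; exact hee x

lemma aug_eq (P : V4 k X) : P.aug = LinearMap.range P.A1 ⊔ LinearMap.range P.B1 := rfl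

lemma A1_mem [CharP k 2] {P : V4 k X} {y : X} (hy : y ∈ P.aug) : P.A1 y ∈ LinearMap.range P.s := by
  rw [aug_eq, Submodule.mem_sup] at hy
  obtain ⟨_, hu, _, ⟨v, rfl⟩, rfl⟩ := hy
  rw [map_add, LinearMap.mem_ker.1 (rangeA_le P hu), zero_add]
  exact ⟨v, by simp [A1_apply, B1_apply, s_apply]; abel⟩

lemma B1_mem [CharP k 2] {P : V4 k X} {y : X} (hy : y ∈ P.aug) : P.B1 y ∈ LinearMap.range P.s := by
  rw [aug_eq, Submodule.mem_sup] at hy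
  obtain ⟨_, ⟨u, rfl⟩, _, ⟨v, rfl⟩, rfl⟩ := hy
  have : P.B1 (P.B1 v) = 0 := by
    rw [← LinearMap.mem_ker, mem_kerB]; simp [B1_apply, add_comm]
  rw [map_add, this, add_zero]
  exact ⟨u, by simp [A1_apply, B1_apply, s_apply]; abel⟩

lemma aug_le [CharP k 2] [FiniteDimensional k X] (P : V4 k X) :
    finrank k P.aug ≤ 2 * finrank k (LinearMap.range P.s) + finrank k P.fix := by
  have h1 := finrank_map_inf P.A1 P.aug
  have h2 := finrank_map_inf P.B1 (P.aug ⊓ LinearMap.ker P.A1)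
  have h3 : P.aug.map P.A1 ≤ LinearMap.range P.s := by
    rintro _ ⟨y, hy, rfl⟩; exact A1_mem hy
  have h4 : (P.aug ⊓ LinearMap.ker P.A1).map P.B1 ≤ LinearMap.range P.s := by
    rintro _ ⟨y, hy, rfl⟩; exact B1_mem hy.1
  have h5 : P.aug ⊓ LinearMap.ker P.A1 ⊓ LinearMap.ker P.B1 ≤ P.fix := by
    rw [fix_eq]; exact fun x hx => ⟨hx.1.2, hx.2⟩
  have := Submodule.finrank_mono h3
  have := Submodule.finrank_mono h4
  have := Submodule.finrank_mono h5
  omega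

lemma Seq.s_i {PK : V4 k X} {PP : V4 k Y} {PX : V4 k Z} (S : Seq PK PP PX) (x : X) :
    S.i (PK.s x) = PP.s (S.i x) := by
  simp [s_apply, S.ei.1, S.ei.2]

lemma Seq.s_p {PK : V4 k X} {PP : V4 k Y} {PX : V4 k Z} (S : Seq PK PP PX) (x : Y) :
    S.p (PP.s x) = PX.s (S.p x) := by
  simp [s_apply, S.ep.1, S.ep.2]

lemma Seq.dims [CharP k 2] [FiniteDimensional k X] [FiniteDimensional k Y] [FiniteDimensional k Z]
    {PK : V4 k X} {PP : V4 k Y} {PX : V4 k Z} (S : Seq PK PP PX)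
    (hP : PP.Hig) :
    finrank k X + finrank k Z = finrank k Y ∧
    4 * finrank k (LinearMap.range PK.s) + 4 * finrank k Z =
      finrank k Y + 4 * finrank k PX.aug ∧
    4 * finrank k PK.fix + 4 * finrank k (LinearMap.range PX.s) = finrank k Y := by
  have h0 : finrank k X + finrank k Z = finrank k Y := by
    have := LinearMap.finrank_range_add_finrank_ker S.p
    rw [← S.ex, LinearMap.range_eq_top.2 S.hp, finrank_top,
      LinearMap.finrank_range_of_inj S.hi] at this
    omega
  have hY := hP.finrank_eq
  have haug : PP.aug = LinearMap.ker PP.s := le_antisymm (aug_le_ker PP) hP.ker_le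
  have hsY := LinearMap.finrank_range_add_finrank_ker PP.s
  have hsX := LinearMap.finrank_range_add_finrank_ker PK.s
  refine ⟨h0, ?_, ?_⟩
  · have e1 : (LinearMap.ker PK.s).map S.i = PP.aug ⊓ LinearMap.ker S.p := by
      rw [haug, ← S.ex]
      ext y; constructor
      · rintro ⟨x, hx, rfl⟩
        exact ⟨by rw [SetLike.mem_coe, LinearMap.mem_ker, ← S.s_i, LinearMap.mem_ker.1 hx, map_zero],
          ⟨x, rfl⟩⟩
      · rintro ⟨hy, ⟨x, rfl⟩⟩
        refine ⟨x, ?_, rfl⟩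
        rw [SetLike.mem_coe, LinearMap.mem_ker] at hy ⊢
        apply S.hi; rw [S.s_i, hy, map_zero]
    have e2 : PP.aug.map S.p = PX.aug := by
      rw [aug_eq, aug_eq, Submodule.map_sup, ← LinearMap.range_comp, ← LinearMap.range_comp]
      have c1 : S.p ∘ₗ PP.A1 = PX.A1 ∘ₗ S.p := by ext y; simp [A1_apply, S.ep.1]
      have c2 : S.p ∘ₗ PP.B1 = PX.B1 ∘ₗ S.p := by ext y; simp [B1_apply, S.ep.2]
      rw [c1, c2, LinearMap.range_comp_of_range_eq_top _ (LinearMap.range_eq_top.2 S.hp),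
        LinearMap.range_comp_of_range_eq_top _ (LinearMap.range_eq_top.2 S.hp)]
    have h1 := finrank_map_inf S.p PP.aug
    rw [e2, ← e1, finrank_map_inj _ S.hi] at h1
    rw [haug] at h1; omega
  · have e1 : PK.fix.map S.i = LinearMap.range PP.s ⊓ LinearMap.ker S.p := by
      rw [← S.ex, ← le_antisymm hP.fix_le (range_s_le_fix PP)]
      ext y; constructor
      · rintro ⟨x, hx, rfl⟩
        refine ⟨?_, ⟨x, rfl⟩⟩
        have := mem_fix.1 hx
        rw [SetLike.mem_coe, mem_fix, ← S.ei.1, ← S.ei.2, this.1, this.2]; simp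
      · rintro ⟨hy, ⟨x, rfl⟩⟩
        refine ⟨x, ?_, rfl⟩
        rw [SetLike.mem_coe, mem_fix] at hy ⊢
        rw [← S.ei.1, ← S.ei.2] at hy
        exact ⟨S.hi hy.1, S.hi hy.2⟩
    have e2 : (LinearMap.range PP.s).map S.p = LinearMap.range PX.s := by
      rw [← LinearMap.range_comp]
      have c1 : S.p ∘ₗ PP.s = PX.s ∘ₗ S.p := by ext y; simp [S.s_p]
      rw [c1, LinearMap.range_comp_of_range_eq_top _ (LinearMap.range_eq_top.2 S.hp)]
    have h1 := finrank_map_inf S.p (LinearMap.range PP.s)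
    rw [e2, ← e1, finrank_map_inj _ S.hi] at h1
    omega

/-- the inductive growth condition -/
def Grow (P : V4 k X) (n : ℕ) : Prop :=
  n + 4 * finrank k (LinearMap.range P.s) ≤ finrank k X ∧
  2 + finrank k X + 4 * finrank k P.aug ≤ 3 * finrank k X + 4 * finrank k (LinearMap.range P.s)

lemma Seq.grow [CharP k 2] [FiniteDimensional k X] [FiniteDimensional k Y] [FiniteDimensional k Z]
    {PK : V4 k X} {PP : V4 k Y} {PX : V4 k Z} (S : Seq PK PP PX)
    (hP : PP.Hig) (n : ℕ) (h : PX.Grow n) : PK.Grow (n + 2) := by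
  obtain ⟨h1, h2, h3⟩ := S.dims hP
  have h4 := aug_le PK
  have h5 := hP.finrank_eq
  unfold Grow at *
  omega

/-- trivial module -/
def triv (k : Type*) [Field k] : V4 k k :=
  ⟨LinearMap.id, LinearMap.id, fun _ => rfl, fun _ => rfl, fun _ => rfl⟩

lemma triv_stEnd : (triv k).StEnd := by
  intro φ _
  refine ⟨φ 1, 0, ?_⟩
  ext; simp [tr_apply]

lemma triv_grow [CharP k 2] : (triv k).Grow 1 := by
  have h1 : (triv k).s = 0 := by
    ext
    have h2 : (1 + 1 : k) = 0 := CharTwo.add_self_eq_zero 1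
    simp [s_apply, triv, h2]
  have h2 : (triv k).aug = ⊥ := by
    have h2 : (1 + 1 : k) = 0 := CharTwo.add_self_eq_zero 1
    have : (LinearMap.id + LinearMap.id : k →ₗ[k] k) = 0 := by ext; simp [h2]
    simp [aug, triv, this]
  unfold Grow
  rw [h1, h2]
  simp

open TensorProduct in
/-- diagonal action on the tensor product -/
def tensor (P : V4 k X) (Q : V4 k Y) : V4 k (X ⊗[k] Y) where
  a := TensorProduct.map P.a Q.a
  b := TensorProduct.map P.b Q.b
  haa x := by
    induction x with
    | zero => simp
    | tmul x y => simp
    | add x y hx hy => rw [map_add, map_add, hx, hy]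
  hbb x := by
    induction x with
    | zero => simp
    | tmul x y => simp
    | add x y hx hy => rw [map_add, map_add, hx, hy]
  hba x := by
    induction x with
    | zero => simp
    | tmul x y => simp
    | add x y hx hy => simp only [map_add, hx, hy]

lemma Hig.tensor (P : V4 k X) {Q : V4 k Y} (hQ : Q.Hig) : (P.tensor Q).Hig := by
  obtain ⟨h, hh⟩ := hQ
  refine ⟨TensorProduct.map LinearMap.id h, ?_⟩
  apply TensorProduct.ext'
  intro x y
  have := congrArg (fun f => f y) hh
  simp only [tr_apply, LinearMap.id_apply] at this
  simp only [tr_apply, V4.tensor, TensorProduct.map_tmul, LinearMap.id_apply, haa, hbb, hba,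
    ← TensorProduct.tmul_add, this]

open TensorProduct in
lemma Seq.tensor (P : V4 k X) {PK : V4 k Y} {W : Type*} [AddCommGroup W] [Module k W]
    {PP : V4 k W} (S : Seq PK PP (triv k)) :
    Nonempty (Seq (P.tensor PK) (P.tensor PP) P) := by
  refine ⟨⟨LinearMap.lTensor X S.i, (TensorProduct.rid k X).toLinearMap ∘ₗ LinearMap.lTensor X S.p,
    Module.Flat.lTensor_preserves_injective_linearMap _ S.hi, ?_, ?_, ?_, ?_⟩⟩
  · exact (TensorProduct.rid k X).surjective.comp (LinearMap.lTensor_surjective X S.hp)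
  · rw [LinearEquiv.ker_comp]
    exact ((lTensor_exact X (LinearMap.exact_iff.2 S.ex.symm) S.hp).linearMap_ker_eq).symm
  · constructor <;> intro x <;> induction x with
    | zero => simp
    | tmul x y => simp [V4.tensor, S.ei.1, S.ei.2]
    | add x y hx hy => simp only [map_add, hx, hy]
  · constructor <;> intro x <;> induction x with
    | zero => simp
    | tmul x y => simp [V4.tensor, S.ep.1, S.ep.2, triv]
    | add x y hx hy => simp only [map_add, hx, hy]

/-- the conclusion on idempotents -/
lemma idem_rank [CharP k 2] [FiniteDimensional k X] (P : V4 k X) (hE : P.StEnd)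
    (e : X →ₗ[k] X) (he : Eqv P P e) (hee : ∀ x, e (e x) = e x)
    (hnt : ¬ ∃ f, e = tr P P f) :
    finrank k X ≤ finrank k (LinearMap.range e) + 4 * finrank k (LinearMap.range P.s) := by
  obtain ⟨c, f, hf⟩ := hE e he
  have hce : c • e + tr P P (f ∘ₗ e) = e := by
    rw [← tr_comp _ he]
    ext x
    have := congrArg (fun g => g (e x)) hf
    simp only [hee, LinearMap.add_apply, LinearMap.smul_apply, LinearMap.id_apply] at this
    simpa using this.symm
  have hc : c = 1 := by
    by_contra hne
    apply hnt
    refine ⟨(1 - c)⁻¹ • (f ∘ₗ e), ?_⟩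
    rw [tr_smul]
    have h1 : tr P P (f ∘ₗ e) = (1 - c) • e := by
      rw [sub_smul, one_smul, eq_sub_iff_add_eq, add_comm]; exact hce
    rw [h1, smul_smul, inv_mul_cancel₀ (sub_ne_zero.2 (Ne.symm hne)), one_smul]
  subst hc
  -- ker e is a submodule that is free
  have hN : ∀ x ∈ LinearMap.ker e, P.a x ∈ LinearMap.ker e := fun x hx => by
    rw [LinearMap.mem_ker, he.1, LinearMap.mem_ker.1 hx, map_zero]
  have hN' : ∀ x ∈ LinearMap.ker e, P.b x ∈ LinearMap.ker e := fun x hx => by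
    rw [LinearMap.mem_ker, he.2, LinearMap.mem_ker.1 hx, map_zero]
  let Q : V4 k (LinearMap.ker e) := ⟨P.a.restrict hN, P.b.restrict hN',
    fun x => Subtype.ext (by simp), fun x => Subtype.ext (by simp), fun x => Subtype.ext (by simp)⟩
  have hi : Eqv Q P (LinearMap.ker e).subtype := ⟨fun x => rfl, fun x => rfl⟩
  let pr : X →ₗ[k] LinearMap.ker e := LinearMap.codRestrict _ (LinearMap.id - e)
    (fun x => by simp [hee])
  have hpr : Eqv P Q pr := by
    constructor <;> intro x <;> apply Subtype.ext <;> simp [pr, Q, he.1, he.2]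
  have hQ : Q.Hig := by
    refine ⟨-(pr ∘ₗ f ∘ₗ (LinearMap.ker e).subtype), ?_⟩
    have h1 : tr Q Q (pr ∘ₗ f ∘ₗ (LinearMap.ker e).subtype) =
        pr ∘ₗ tr P P f ∘ₗ (LinearMap.ker e).subtype := by
      rw [tr_comp _ hi, comp_tr _ hpr]
    have h2 : -(pr ∘ₗ f ∘ₗ (LinearMap.ker e).subtype) =
      (-1 : k) • (pr ∘ₗ f ∘ₗ (LinearMap.ker e).subtype) := (neg_one_smul k _).symm
    rw [h2, tr_smul, h1]
    ext x
    have hx : e x.1 = 0 := x.2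
    have h3 : tr P P f x.1 = - x.1 := by
      have := congrArg (fun g => g x.1) hf
      simp only [LinearMap.add_apply, one_smul, LinearMap.id_apply, hx] at this
      exact (neg_eq_of_add_eq_zero_right this.symm).symm
    simp [pr, h3, hx]
  have h1 := hQ.finrank_eq
  have h2 : finrank k (LinearMap.range Q.s) ≤ finrank k (LinearMap.range P.s) := by
    rw [← finrank_map_inj _ (LinearMap.ker e).injective_subtype]
    apply Submodule.finrank_mono
    rintro _ ⟨_, ⟨x, rfl⟩, rfl⟩
    exact ⟨x.1, rfl⟩
  have h3 := LinearMap.finrank_range_add_finrank_ker e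
  omega

end V4
end PSLNA


namespace PSLNA

set_option linter.unusedSectionVars false
set_option linter.unusedDecidableInType false

open Module Finset

section field
variable {F : Type*} [Field F] [Fintype F] [DecidableEq F] [hq : Fact (Fintype.card F % 8 = 7)]

lemma neg_one_nonsq : ¬ IsSquare (-1 : F) := by
  rw [FiniteField.isSquare_neg_one_iff]; have := hq.out; omega

lemma two_ne : (2 : F) ≠ 0 := by
  have h : ringChar F ≠ 2 := by
    intro h
    have := FiniteField.even_card_of_char_two h
    have := hq.out
    omega
  exact Ring.two_ne_zero h

lemma four_ne : (4 : F) ≠ 0 := by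
  have : (4 : F) = 2 * 2 := by norm_num
  rw [this]; exact mul_ne_zero two_ne two_ne

lemma not_sq_neg {z : F} (hz : z ≠ 0) (h : IsSquare z) : ¬ IsSquare (-z) := by
  intro h2
  apply neg_one_nonsq (F := F)
  have : (-1 : F) = -z / z := by field_simp
  rw [this]; exact h2.div h

lemma sq_or (z : F) : IsSquare z ∨ IsSquare (-z) := by
  by_contra! h
  have hF : ringChar F ≠ 2 := fun h => by
    have := FiniteField.even_card_of_char_two h
    have := hq.out
    omega
  have h1 := (quadraticChar_neg_one_iff_not_isSquare (F := F)).2 h.1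
  have h2 := (quadraticChar_neg_one_iff_not_isSquare (F := F)).2 h.2
  have h3 := (quadraticChar_neg_one_iff_not_isSquare (F := F)).2 neg_one_nonsq
  rw [← neg_one_mul, map_mul, h1, h3] at h2
  norm_num at h2

lemma sq_neg_iff {z : F} (hz : z ≠ 0) : IsSquare (-z) ↔ ¬ IsSquare z := by
  constructor
  · intro h h2; exact not_sq_neg hz h2 h
  · intro h; exact (sq_or z).resolve_left h

variable (F) in
/-- nonzero squares -/
def SS : Finset F := univ.filter (fun z => z ≠ 0 ∧ IsSquare z)

lemma mem_SS {z : F} : z ∈ SS F ↔ z ≠ 0 ∧ IsSquare z := by simp [SS]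

lemma neg_mem_SS {z : F} (hz : z ≠ 0) : -z ∈ SS F ↔ z ∉ SS F := by
  rw [mem_SS, mem_SS, sq_neg_iff hz]; simp [hz]

lemma sum_half {A : Type*} [AddCommMonoid A] (g : F → A) :
    ∑ z, g z = g 0 + ∑ z ∈ SS F, (g z + g (-z)) := by
  have h1 : (univ : Finset F) = insert 0 (SS F ∪ (SS F).image (fun z => -z)) := by
    ext z
    simp only [mem_univ, mem_insert, mem_union, mem_image, true_iff]
    by_cases hz : z = 0
    · exact Or.inl hz
    · right
      by_cases h : z ∈ SS F
      · exact Or.inl h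
      · exact Or.inr ⟨-z, (neg_mem_SS hz).2 h, by simp⟩
  rw [h1, sum_insert, sum_union, sum_image, sum_add_distrib]
  · intro a _ b _ h; simpa using h
  · rw [disjoint_left]
    intro z hz h
    obtain ⟨y, hy, rfl⟩ := mem_image.1 h
    exact (neg_mem_SS (mem_SS.1 hy).1).1 hz hy
  · simp [mem_SS]

lemma card_SS : 2 * (SS F).card + 1 = Fintype.card F := by
  have := sum_half (F := F) (fun _ => 1)
  simp at this
  omega

variable (F) in
lemma exists_mn : ∃ m n : F, m ≠ 0 ∧ n ≠ 0 ∧ m ^ 2 + n ^ 2 = -1 := by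
  obtain ⟨m, n, h⟩ := FiniteField.exists_root_sum_quadratic (R := F)
    (f := Polynomial.X ^ 2) (g := Polynomial.X ^ 2 + Polynomial.C 1) (by simp) (by
      compute_degree!) (by have := hq.out; omega)
  simp at h
  refine ⟨m, n, ?_, ?_, by linear_combination h⟩
  · rintro rfl
    apply neg_one_nonsq (F := F)
    exact ⟨n, by linear_combination -h⟩
  · rintro rfl
    apply neg_one_nonsq (F := F)
    exact ⟨m, by linear_combination -h⟩

/-- square root within the squares -/
lemma exists_sqrt {z : F} (hz : IsSquare z) (h0 : z ≠ 0) : ∃ y ∈ SS F, y ^ 2 = z := by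
  obtain ⟨y, rfl⟩ := hz
  have hy : y ≠ 0 := by rintro rfl; simp at h0
  by_cases h : y ∈ SS F
  · exact ⟨y, h, by ring⟩
  · exact ⟨-y, (neg_mem_SS hy).2 h, by ring⟩

lemma sq_inj {y z : F} (hy : y ∈ SS F) (hz : z ∈ SS F) (h : y ^ 2 = z ^ 2) : y = z := by
  rcases sq_eq_sq_iff_eq_or_eq_neg.1 h with h | h
  · exact h
  · exfalso
    rw [h] at hy
    exact (neg_mem_SS (mem_SS.1 hz).1).1 hy hz

end field

section chars
variable {F k : Type*} [Field F] [Fintype F] [DecidableEq F] [hq : Fact (Fintype.card F % 8 = 7)]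
  [Field k] [CharP k 2]

variable (F k) in
lemma card_one : ((Fintype.card F : ℕ) : k) = 1 := by
  have h := hq.out
  have : Fintype.card F = 2 * (Fintype.card F / 2) + 1 := by omega
  rw [this]; push_cast; simp [CharTwo.two_eq_zero]

variable (ψ : AddChar F k) [hψ : Fact (ψ ≠ 1)]

lemma sum_psi (b : F) : ∑ x, ψ (x * b) = if b = 0 then 1 else 0 := by
  have := AddChar.sum_mulShift b (AddChar.IsPrimitive.of_ne_one hψ.out)
  rw [this]
  split_ifs <;> simp [card_one F k]

lemma sum_psi' (b : F) : ∑ x, ψ (b * x) = if b = 0 then 1 else 0 := by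
  rw [← sum_psi ψ b]; simp [mul_comm]

lemma sum_even (g : F → k) (hg : ∀ z, g (-z) = g z) : ∑ z, g z = g 0 := by
  rw [sum_half]
  simp [hg, CharTwo.add_self_eq_zero]

lemma gauss (α β : F) (hα : α ≠ 0) : ∑ z, ψ (α * z ^ 2 + β * z) = ψ (-(β ^ 2 / (4 * α))) := by
  have h4 := four_ne (F := F)
  have h2 := two_ne (F := F)
  have h1 : ∀ z, ψ (α * z ^ 2 + β * z) =
      ψ (-(β ^ 2 / (4 * α))) * (fun z => ψ (α * z ^ 2)) (z + β / (2 * α)) := by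
    intro z
    rw [← AddChar.map_add_eq_mul]
    congr 1
    field_simp
    ring
  simp_rw [h1]
  have h3 := Equiv.sum_comp (Equiv.addRight (β / (2 * α))) (fun z => ψ (α * z ^ 2))
  simp only [Equiv.coe_addRight] at h3
  rw [← mul_sum, h3, sum_even]
  · simp
  · simp

end chars
end PSLNA


namespace PSLNA

set_option linter.unusedSectionVars false
set_option linter.unusedDecidableInType false

open Module Finset

section weil
variable {F k : Type*} [Field F] [Fintype F] [DecidableEq F] [hq : Fact (Fintype.card F % 8 = 7)]
  [Field k] [CharP k 2] (ψ : AddChar F k) [hψ : Fact (ψ ≠ 1)]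

def opU (x : F) : (F → k) →ₗ[k] (F → k) where
  toFun φ y := ψ (x * y ^ 2) * φ y
  map_add' φ χ := by ext y; simp [mul_add]
  map_smul' c φ := by ext y; simp [mul_left_comm]

def opT (c : F) : (F → k) →ₗ[k] (F → k) where
  toFun φ y := φ (c * y)
  map_add' φ χ := by ext y; simp
  map_smul' c φ := by ext y; simp

def opW : (F → k) →ₗ[k] (F → k) where
  toFun φ y := ∑ z, ψ (-(2 * y * z)) * φ z
  map_add' φ χ := by ext y; simp [mul_add, sum_add_distrib]
  map_smul' c φ := by ext y; simp [mul_sum, mul_left_comm]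

lemma opU_apply (x : F) (φ : F → k) (y : F) : opU ψ x φ y = ψ (x * y ^ 2) * φ y := rfl
lemma opT_apply (x : F) (φ : F → k) (y : F) : opT x φ y = φ (x * y) := rfl
lemma opW_apply (φ : F → k) (y : F) : opW ψ φ y = ∑ z, ψ (-(2 * y * z)) * φ z := rfl

/-- the vectors `E_P` for `P = [p : r]` -/
def EE (p r : F) : F → k := if r = 0 then Pi.single 0 1 else fun y => ψ (p / r * y ^ 2)

lemma EE_zero (p : F) : EE ψ p 0 = Pi.single 0 1 := if_pos rfl
lemma EE_ne (p : F) {r : F} (hr : r ≠ 0) : EE ψ p r = fun y => ψ (p / r * y ^ 2) := if_neg hr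

lemma EE_smul (c p r : F) (hc : c ≠ 0) : EE ψ (c * p) (c * r) = EE ψ p r := by
  by_cases hr : r = 0
  · subst hr; simp [EE_zero]
  · rw [EE_ne _ _ (mul_ne_zero hc hr), EE_ne _ _ hr]
    ext y; congr 1; field_simp

lemma opU_EE (x p r : F) : opU ψ x (EE ψ p r) = EE ψ (p + x * r) r := by
  by_cases hr : r = 0
  · subst hr; simp only [EE_zero]
    ext y; rw [opU_apply]
    by_cases hy : y = 0
    · subst hy; simp
    · simp [hy]
  · rw [EE_ne _ _ hr, EE_ne _ _ hr]
    ext y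
    rw [opU_apply, ← AddChar.map_add_eq_mul]
    congr 1; field_simp; ring

lemma opT_EE (c p r : F) (hc : c ≠ 0) : opT c (EE ψ p r) = EE ψ (c * p) (r / c) := by
  by_cases hr : r = 0
  · subst hr; simp only [EE_zero, zero_div]
    ext y; rw [opT_apply]
    by_cases hy : y = 0
    · subst hy; simp
    · simp [hy, hc]
  · rw [EE_ne _ _ hr, EE_ne _ _ (div_ne_zero hr hc)]
    ext y
    rw [opT_apply]
    congr 1; field_simp

lemma opW_EE (p r : F) (h : p ≠ 0 ∨ r ≠ 0) : opW ψ (EE ψ p r) = EE ψ (-r) p := by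
  have h2 := two_ne (F := F)
  have h4 := four_ne (F := F)
  by_cases hr : r = 0
  · subst hr
    have hp : p ≠ 0 := by simpa using h
    rw [EE_zero, EE_ne _ _ hp]
    ext y
    rw [opW_apply, sum_eq_single 0] <;> simp +contextual
  · rw [EE_ne _ _ hr]
    by_cases hp : p = 0
    · subst hp
      rw [EE_zero]
      ext y
      rw [opW_apply]
      have := sum_psi' ψ (-(2 * y))
      simp only [zero_div, zero_mul, AddChar.map_zero_eq_one, mul_one]
      simp only [neg_mul] at this
      rw [this]
      by_cases hy : y = 0 <;> simp [hy, h2]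
    · rw [EE_ne _ _ hp]
      ext y
      rw [opW_apply]
      have := gauss ψ (p / r) (-(2 * y)) (div_ne_zero hp hr)
      simp_rw [← AddChar.map_add_eq_mul]
      calc _ = _ := ?_
        _ = _ := this
        _ = _ := ?_
      · refine sum_congr rfl fun z _ => ?_
        congr 1; ring
      · congr 1; field_simp; ring

open Matrix in
/-- Weil operators -/
def om (g : SpecialLinearGroup (Fin 2) F) : (F → k) →ₗ[k] (F → k) :=
  if g 1 0 = 0 then opU ψ (g 0 0 * g 0 1) ∘ₗ opT (g 0 0)
  else opU ψ (g 0 0 / g 1 0) ∘ₗ opT (1 / g 1 0) ∘ₗ opW ψ ∘ₗ opU ψ (g 1 1 / g 1 0)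

open Matrix in
lemma om_EE (g : SpecialLinearGroup (Fin 2) F) (p r : F) (h : p ≠ 0 ∨ r ≠ 0) :
    om ψ g (EE ψ p r) = EE ψ (g 0 0 * p + g 0 1 * r) (g 1 0 * p + g 1 1 * r) := by
  have hd : g 0 0 * g 1 1 - g 0 1 * g 1 0 = 1 := by
    rw [← Matrix.det_fin_two]; exact g.2
  unfold om
  split_ifs with hc
  · rw [hc, mul_zero, sub_zero] at hd
    have ha : g 0 0 ≠ 0 := left_ne_zero_of_mul_eq_one hd
    rw [LinearMap.comp_apply, opT_EE _ _ _ _ ha, opU_EE, hc]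
    have : g 1 1 = 1 / g 0 0 := by field_simp; rw [mul_comm]; exact hd
    rw [this]
    congr 1 <;> field_simp; ring
  · simp only [LinearMap.comp_apply]
    rw [opU_EE, opW_EE, opT_EE _ _ _ _ (one_div_ne_zero hc), opU_EE]
    · congr 1
      · field_simp; linear_combination r * hd
      · field_simp
    · by_cases hr : r = 0
      · left; simpa [hr] using h
      · exact Or.inr hr

variable (F k) in
/-- even functions -/
def Vp : Submodule k (F → k) where
  carrier := {φ | ∀ y, φ (-y) = φ y}
  add_mem' {a b} ha hb y := by simp [ha y, hb y]
  zero_mem' y := rfl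
  smul_mem' c a ha y := by simp [ha y]

lemma mem_Vp {φ : F → k} : φ ∈ Vp F k ↔ ∀ y, φ (-y) = φ y := Iff.rfl

lemma opU_mem (x : F) {φ : F → k} (h : φ ∈ Vp F k) : opU ψ x φ ∈ Vp F k := fun y => by
  simp [opU_apply, h y]

lemma opT_mem (x : F) {φ : F → k} (h : φ ∈ Vp F k) : opT x φ ∈ Vp F k := fun y => by
  simp [opT_apply, h (x * y)]

lemma opW_mem {φ : F → k} (h : φ ∈ Vp F k) : opW ψ φ ∈ Vp F k := fun y => by
  rw [opW_apply, opW_apply, ← Equiv.sum_comp (Equiv.neg F)]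
  simp [h _]

lemma EE_mem (p r : F) : EE ψ p r ∈ Vp F k := by
  by_cases hr : r = 0
  · subst hr; rw [EE_zero]; intro y
    by_cases hy : y = 0 <;> simp [hy]
  · rw [EE_ne _ _ hr]; intro y; simp

lemma om_mem (g : Matrix.SpecialLinearGroup (Fin 2) F) {φ : F → k} (h : φ ∈ Vp F k) :
    om ψ g φ ∈ Vp F k := by
  unfold om
  split_ifs
  · exact opU_mem _ _ (opT_mem _ h)
  · exact opU_mem _ _ (opT_mem _ (opW_mem _ (opU_mem _ _ h)))

/-- `δ_s + δ_{-s}` -/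
lemma delta_eq (s : F) (hs : s ≠ 0) :
    ∑ x, ψ (-(x * s ^ 2)) • EE ψ x 1 = (Pi.single s 1 + Pi.single (-s) 1 : F → k) := by
  ext y
  have := sum_psi ψ (y ^ 2 - s ^ 2)
  simp only [Finset.sum_apply, Pi.smul_apply, EE_ne ψ _ one_ne_zero, smul_eq_mul,
    ← AddChar.map_add_eq_mul]
  calc _ = _ := ?_
    _ = _ := this
    _ = _ := ?_
  · refine sum_congr rfl fun z _ => ?_
    congr 1; simp; ring
  · have hss : s ≠ -s := fun h => by
      have : 2 * s = 0 := by linear_combination h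
      rcases mul_eq_zero.1 this with h | h
      · exact two_ne h
      · exact hs h
    by_cases h1 : y = s
    · subst h1; simp [hss]
    · by_cases h2 : y = -s
      · subst h2; simp [hss.symm]
      · have : y ^ 2 - s ^ 2 ≠ 0 := fun h => by
          rcases sq_eq_sq_iff_eq_or_eq_neg.1 (sub_eq_zero.1 h) with h | h
          · exact h1 h
          · exact h2 h
        simp [h1, h2, this]

lemma Vp_decomp {φ : F → k} (h : φ ∈ Vp F k) : φ = φ 0 • Pi.single 0 1 +
    ∑ s ∈ SS F, φ s • (Pi.single s 1 + Pi.single (-s) 1 : F → k) := by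
  ext y
  have h1 := sum_half (fun z => φ z * (Pi.single z (1 : k) : F → k) y)
  have h2 : ∑ z, φ z * (Pi.single z (1 : k) : F → k) y = φ y := by
    rw [sum_eq_single y]
    · simp
    · intro b _ hb; simp [hb.symm]
    · simp
  rw [h2] at h1
  rw [h1]
  simp [h _, mul_add]

lemma ext_EE {Y : Type*} [AddCommGroup Y] [Module k Y] (f g : (F → k) →ₗ[k] Y)
    (hfg : ∀ p r : F, (p ≠ 0 ∨ r ≠ 0) → f (EE ψ p r) = g (EE ψ p r)) {φ : F → k}
    (h : φ ∈ Vp F k) : f φ = g φ := by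
  rw [Vp_decomp h]
  simp only [map_add, map_sum, map_smul]
  congr 1
  · have := hfg 1 0 (Or.inl one_ne_zero)
    rw [EE_zero] at this; rw [this]
  · refine sum_congr rfl fun s hs => ?_
    congr 1
    rw [← map_add, ← map_add, ← delta_eq ψ s (mem_SS.1 hs).1, map_sum, map_sum]
    refine sum_congr rfl fun x _ => ?_
    rw [map_smul, map_smul, hfg _ _ (Or.inr one_ne_zero)]

lemma mulvec_ne (g : Matrix.SpecialLinearGroup (Fin 2) F) (p r : F) (h : p ≠ 0 ∨ r ≠ 0) :
    (g 0 0 * p + g 0 1 * r) ≠ 0 ∨ (g 1 0 * p + g 1 1 * r) ≠ 0 := by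
  have hd : g 0 0 * g 1 1 - g 0 1 * g 1 0 = 1 := by
    rw [← Matrix.det_fin_two]; exact g.2
  by_contra! hh
  have h1 : p = 0 := by linear_combination g 1 1 * hh.1 - g 0 1 * hh.2 - p * hd
  have h2 : r = 0 := by linear_combination g 0 0 * hh.2 - g 1 0 * hh.1 - r * hd
  simp [h1, h2] at h

lemma om_mul (g h : Matrix.SpecialLinearGroup (Fin 2) F) {φ : F → k} (hφ : φ ∈ Vp F k) :
    om ψ (g * h) φ = om ψ g (om ψ h φ) := by
  rw [← LinearMap.comp_apply]
  refine ext_EE ψ _ _ ?_ hφ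
  intro p r hpr
  rw [LinearMap.comp_apply, om_EE _ _ _ _ hpr, om_EE _ _ _ _ hpr, om_EE _ _ _ _ (mulvec_ne _ _ _ hpr)]
  congr 1 <;> simp [Matrix.mul_apply, Fin.sum_univ_two] <;> ring

lemma om_scalar (g : Matrix.SpecialLinearGroup (Fin 2) F) (c : F)
    (h00 : g 0 0 = c) (h01 : g 0 1 = 0) (h10 : g 1 0 = 0) (h11 : g 1 1 = c)
    {φ : F → k} (hφ : φ ∈ Vp F k) : om ψ g φ = φ := by
  have hd : g 0 0 * g 1 1 - g 0 1 * g 1 0 = 1 := by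
    rw [← Matrix.det_fin_two]; exact g.2
  refine ext_EE ψ _ LinearMap.id ?_ hφ
  intro p r hpr
  rw [om_EE _ _ _ _ hpr, LinearMap.id_apply, h00, h01, h10, h11]
  simp only [zero_mul, add_zero, zero_add]
  apply EE_smul
  rintro rfl
  simp [h00, h01] at hd

/-- Weil representation of `SL_2` on even functions -/
def weilSL : Matrix.SpecialLinearGroup (Fin 2) F →* (Vp F k →ₗ[k] Vp F k) where
  toFun g := (om ψ g).restrict (fun _ h => om_mem ψ g h)
  map_one' := by
    ext φ : 1
    apply Subtype.ext
    exact om_scalar ψ 1 1 (by simp) (by simp) (by simp) (by simp) φ.2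
  map_mul' g h := by
    ext φ : 1
    apply Subtype.ext
    exact om_mul ψ g h φ.2

/-- Weil representation of `PSL_2` on even functions -/
def weil : (Matrix.SpecialLinearGroup (Fin 2) F ⧸
    Subgroup.center (Matrix.SpecialLinearGroup (Fin 2) F)) →* (Vp F k →ₗ[k] Vp F k) :=
  QuotientGroup.lift _ (weilSL ψ) (by
    intro g hg
    obtain ⟨c, -, hc⟩ := Matrix.SpecialLinearGroup.mem_center_iff.1 hg
    have e : ∀ i j, g i j = (Matrix.scalar (Fin 2) c) i j := fun i j => by rw [hc]
    ext φ : 1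
    apply Subtype.ext
    refine om_scalar ψ g c ?_ ?_ ?_ ?_ φ.2 <;> rw [e] <;> simp)

lemma weil_coe (g : Matrix.SpecialLinearGroup (Fin 2) F) (φ : Vp F k) :
    (weil ψ (g : Matrix.SpecialLinearGroup (Fin 2) F ⧸
    Subgroup.center (Matrix.SpecialLinearGroup (Fin 2) F)) φ).1 = om ψ g φ.1 := rfl

end weil
end PSLNA


namespace PSLNA

set_option linter.unusedSectionVars false
set_option linter.unusedDecidableInType false

open Module Finset

/-- Klein four module from a representation -/
def repV4 {k X G : Type*} [Field k] [AddCommGroup X] [Module k X] [Monoid G]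
    (ρ : G →* (X →ₗ[k] X)) (a b : G) (haa : a * a = 1) (hbb : b * b = 1) (hba : b * a = a * b) :
    V4 k X where
  a := ρ a
  b := ρ b
  haa x := by rw [← Module.End.mul_apply, ← map_mul, haa, map_one]; rfl
  hbb x := by rw [← Module.End.mul_apply, ← map_mul, hbb, map_one]; rfl
  hba x := by rw [← Module.End.mul_apply, ← map_mul, hba, map_mul]; rfl

lemma four_nat {k : Type*} [Field k] (a0 a1 a2 a3 : ℕ) (n1 : a1 ≠ a0) (n2 : a2 ≠ a0) (n3 : a3 ≠ a0)
    (n4 : a3 ≠ a1) (n5 : a3 ≠ a2) (n6 : a1 ≠ a2) (c : k) :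
    (if a0 < a1 ∧ a0 < a2 ∧ a0 < a3 then c else 0) + (if a1 < a0 ∧ a1 < a3 ∧ a1 < a2 then c else 0) +
    (if a2 < a0 ∧ a2 < a3 ∧ a2 < a1 then c else 0) + (if a3 < a0 ∧ a3 < a1 ∧ a3 < a2 then c else 0)
    = c := by
  have h : ∃ b ∈ ({a0, a1, a2, a3} : Finset ℕ), ∀ x ∈ ({a0, a1, a2, a3} : Finset ℕ), b ≤ x :=
    Finset.exists_min_image _ id (by simp)
  obtain ⟨b, hb, hmin⟩ := h
  simp only [mem_insert, mem_singleton] at hb hmin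
  have m0 := hmin a0 (by simp)
  have m1 := hmin a1 (by simp)
  have m2 := hmin a2 (by simp)
  have m3 := hmin a3 (by simp)
  clear hmin
  rcases hb with rfl | rfl | rfl | rfl
  · rw [if_pos ⟨by omega, by omega, by omega⟩, if_neg (by omega), if_neg (by omega), if_neg (by omega)]
    simp
  · rw [if_neg (by omega), if_pos ⟨by omega, by omega, by omega⟩, if_neg (by omega), if_neg (by omega)]
    simp
  · rw [if_neg (by omega), if_neg (by omega), if_pos ⟨by omega, by omega, by omega⟩, if_neg (by omega)]
    simp
  · rw [if_neg (by omega), if_neg (by omega), if_neg (by omega), if_pos ⟨by omega, by omega, by omega⟩]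
    simp

section perm
variable {k Ω : Type*} [Field k] [Fintype Ω]
/-- permutation module -/
def permV4 (k : Type*) [Field k] (α β : Ω → Ω) (haa : ∀ x, α (α x) = x) (hbb : ∀ x, β (β x) = x)
    (hab : ∀ x, α (β x) = β (α x)) : V4 k (Ω → k) where
  a := LinearMap.funLeft k k α
  b := LinearMap.funLeft k k β
  haa f := by ext x; simp [LinearMap.funLeft_apply, haa]
  hbb f := by ext x; simp [LinearMap.funLeft_apply, hbb]
  hba f := by ext x; simp [LinearMap.funLeft_apply, hab]

lemma permV4_hig (α β : Ω → Ω) (haa : ∀ x, α (α x) = x) (hbb : ∀ x, β (β x) = x)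
    (hab : ∀ x, α (β x) = β (α x)) (fa : ∀ x, α x ≠ x) (fb : ∀ x, β x ≠ x)
    (fab : ∀ x, α (β x) ≠ x) : (permV4 k α β haa hbb hab).Hig := by
  classical
  obtain ⟨e⟩ : Nonempty (Ω ≃ Fin (Fintype.card Ω)) := ⟨Fintype.equivFin Ω⟩
  let D : Ω → Prop := fun x => (e x : ℕ) < e (α x) ∧ (e x : ℕ) < e (β x) ∧ (e x : ℕ) < e (α (β x))
  let h : (Ω → k) →ₗ[k] (Ω → k) :=
    { toFun := fun f x => if D x then f x else 0
      map_add' := fun f g => by ext x; by_cases hx : D x <;> simp [hx]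
      map_smul' := fun c f => by ext x; by_cases hx : D x <;> simp [hx] }
  have hh : ∀ f x, h f x = if D x then f x else 0 := fun _ _ => rfl
  refine ⟨h, ?_⟩
  refine LinearMap.ext fun f => ?_
  ext x
  rw [V4.tr_apply]
  simp only [Pi.add_apply, LinearMap.id_apply, permV4, LinearMap.funLeft_apply, hh, haa, hbb, hab]
  have hD1 : D (α x) ↔ (e (α x) : ℕ) < e x ∧ (e (α x) : ℕ) < e (α (β x)) ∧ (e (α x) : ℕ) < e (β x) := by
    simp only [D, haa, hbb, hab]
  have hD2 : D (β x) ↔ (e (β x) : ℕ) < e x ∧ (e (β x) : ℕ) < e (α (β x)) ∧ (e (β x) : ℕ) < e (α x) := by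
    simp only [D, haa, hbb, hab]; tauto
  have hD3 : D (α (β x)) ↔ (e (α (β x)) : ℕ) < e x ∧ (e (α (β x)) : ℕ) < e (α x) ∧
      (e (α (β x)) : ℕ) < e (β x) := by
    simp only [D, haa, hbb, hab]; tauto
  have hD0 : D x ↔ (e x : ℕ) < e (α x) ∧ (e x : ℕ) < e (β x) ∧ (e x : ℕ) < e (α (β x)) := Iff.rfl
  have key : ∀ u v : Ω, u ≠ v → (e u : ℕ) ≠ e v := fun u v huv h => huv (e.injective (Fin.ext h))
  have n1 := key _ _ (fa x)
  have n2 := key _ _ (fb x)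
  have n3 := key _ _ (fab x)
  have n4 := key (α (β x)) (α x) (fun h => fb x (by have := congrArg α h; rwa [haa, haa] at this))
  have n5 := key (α (β x)) (β x) (fa _)
  have n6 := key (α x) (β x) (fun h => fab x (by rw [← h, haa]))
  rw [hab] at hD1 hD2 hD3 hD0 n3 n4 n5
  simp only [hD1, hD2, hD3, hD0]
  exact four_nat _ _ _ _ n1 n2 n3 n4 n5 n6 _

end perm

section dims
variable {F k : Type*} [Field F] [Fintype F] [DecidableEq F] [hq : Fact (Fintype.card F % 8 = 7)]
  [Field k] [CharP k 2]

variable (F k) in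
lemma finrank_Vp : finrank k (Vp F k) = (SS F).card + 1 := by
  let H : Finset F := insert 0 (SS F)
  let r : Vp F k →ₗ[k] (H → k) := LinearMap.funLeft k k Subtype.val ∘ₗ (Vp F k).subtype
  have hb : Function.Bijective r := by
    constructor
    · rw [← LinearMap.ker_eq_bot, LinearMap.ker_eq_bot']
      intro φ hφ
      have h1 : ∀ z ∈ H, φ.1 z = 0 := fun z hz => congrFun hφ ⟨z, hz⟩
      apply Subtype.ext
      rw [Vp_decomp φ.2, h1 0 (by simp [H])]
      rw [sum_eq_zero]
      · simp
      · intro s hs; rw [h1 s (by simp [H, hs])]; simp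
    · intro f
      have h0 : (0 : F) ∉ SS F := by simp [mem_SS]
      refine ⟨⟨fun y => if h : y ∈ H then f ⟨y, h⟩ else if h : -y ∈ H then f ⟨-y, h⟩ else 0, ?_⟩, ?_⟩
      · intro y
        by_cases hy : y = 0
        · subst hy; simp
        · have e := neg_mem_SS hy
          by_cases h : y ∈ SS F
          · have h' : -y ∉ SS F := by tauto
            simp [H, hy, h, h']
          · have h' : -y ∈ SS F := by tauto
            simp [H, hy, h, h']
      · ext ⟨z, hz⟩
        simp [r, LinearMap.funLeft_apply, hz]
  rw [(LinearEquiv.ofBijective r hb).finrank_eq, finrank_fintype_fun_eq_card, Fintype.card_coe,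
    card_insert_of_notMem (by simp [mem_SS])]

variable (F k) in
/-- evaluation at zero -/
def ev0 : Vp F k →ₗ[k] k := LinearMap.proj 0 ∘ₗ (Vp F k).subtype

lemma ev0_apply (φ : Vp F k) : ev0 F k φ = φ.1 0 := rfl

lemma ev0_surj : Function.Surjective (ev0 F k) := fun c => by
  refine ⟨⟨fun _ => c, fun _ => rfl⟩, rfl⟩

lemma finrank_ker_ev0 : finrank k (LinearMap.ker (ev0 F k)) = (SS F).card := by
  have := LinearMap.finrank_range_add_finrank_ker (ev0 F k)
  rw [LinearMap.range_eq_top.2 ev0_surj, finrank_top, finrank_self, finrank_Vp] at this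
  omega

variable (ψ : AddChar F k) [hψ : Fact (ψ ≠ 1)]

lemma om_zero (g : Matrix.SpecialLinearGroup (Fin 2) F) {φ : F → k} (hφ : φ ∈ Vp F k) :
    om ψ g φ 0 = φ 0 := by
  have hW : ∀ χ : F → k, χ ∈ Vp F k → opW ψ χ 0 = χ 0 := fun χ hχ => by
    rw [opW_apply]; simp; exact sum_even _ hχ
  unfold om
  split_ifs
  · simp [opU_apply, opT_apply]
  · simp only [LinearMap.comp_apply, opU_apply, opT_apply, mul_zero]
    rw [hW _ (opU_mem _ _ hφ)]
    simp [opU_apply]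

end dims
end PSLNA


namespace PSLNA

set_option linter.unusedSectionVars false
set_option linter.unusedDecidableInType false

open Module Finset

lemma finrank_prod_le {k X Y : Type*} [Field k] [AddCommGroup X] [Module k X]
    [AddCommGroup Y] [Module k Y] [FiniteDimensional k X] [FiniteDimensional k Y]
    (p : Submodule k X) (q : Submodule k Y) (r : Submodule k (X × Y))
    (h : ∀ z ∈ r, z.1 ∈ p ∧ z.2 ∈ q) : finrank k r ≤ finrank k p + finrank k q := by
  have hmap : r ≤ LinearMap.range (p.subtype.prodMap q.subtype) := by
    intro z hz
    exact ⟨⟨⟨z.1, (h z hz).1⟩, ⟨z.2, (h z hz).2⟩⟩, rfl⟩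
  have := (Submodule.finrank_mono hmap).trans (LinearMap.finrank_range_le _)
  rwa [finrank_prod] at this

section elts
variable {F : Type*} [Field F]

/-- matrix with given entries -/
def mkSL (a b c d : F) (h : a * d - b * c = 1) : Matrix.SpecialLinearGroup (Fin 2) F :=
  ⟨!![a, b; c, d], by rw [Matrix.det_fin_two]; simpa using h⟩

@[simp] lemma mkSL_00 (a b c d : F) (h : a * d - b * c = 1) : mkSL a b c d h 0 0 = a := rfl
@[simp] lemma mkSL_01 (a b c d : F) (h : a * d - b * c = 1) : mkSL a b c d h 0 1 = b := rfl
@[simp] lemma mkSL_10 (a b c d : F) (h : a * d - b * c = 1) : mkSL a b c d h 1 0 = c := rfl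
@[simp] lemma mkSL_11 (a b c d : F) (h : a * d - b * c = 1) : mkSL a b c d h 1 1 = d := rfl

variable (F) in
/-- projective special linear group of rank two -/
abbrev PG : Type _ := Matrix.SpecialLinearGroup (Fin 2) F ⧸
    Subgroup.center (Matrix.SpecialLinearGroup (Fin 2) F)

/-- image in `PSL` -/
def mkP (a b c d : F) (h : a * d - b * c = 1) : PG F := (mkSL a b c d h : Matrix.SpecialLinearGroup (Fin 2) F)

lemma mkP_mul (a b c d a' b' c' d' : F) (h : a * d - b * c = 1) (h' : a' * d' - b' * c' = 1) :
    mkP a b c d h * mkP a' b' c' d' h' =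
    mkP (a * a' + b * c') (a * b' + b * d') (c * a' + d * c') (c * b' + d * d')
      (by linear_combination (a' * d' - b' * c') * h + h') := by
  unfold mkP
  rw [← QuotientGroup.mk_mul]
  congr 1
  apply Subtype.ext
  exact Matrix.mul_fin_two _ _ _ _ _ _ _ _

lemma mkP_one (h : (1 : F) * 1 - 0 * 0 = 1) : mkP (1 : F) 0 0 1 h = 1 := by
  unfold mkP
  rw [← QuotientGroup.mk_one]
  congr 1
  ext i j
  fin_cases i <;> fin_cases j <;> simp [mkSL]

lemma mkP_congr {a b c d a' b' c' d' : F} (h : a * d - b * c = 1) (h' : a' * d' - b' * c' = 1)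
    (ha : a = a') (hb : b = b') (hc : c = c') (hd : d = d') : mkP a b c d h = mkP a' b' c' d' h' := by
  subst ha hb hc hd; rfl

lemma mkP_neg (a b c d : F) (h : a * d - b * c = 1) :
    mkP (-a) (-b) (-c) (-d) (by linear_combination h) = mkP a b c d h := by
  have h1 : mkP (-1 : F) 0 0 (-1) (by ring) = 1 := by
    unfold mkP
    rw [QuotientGroup.eq_one_iff, Matrix.SpecialLinearGroup.mem_center_iff]
    refine ⟨-1, by simp, ?_⟩
    ext i j
    fin_cases i <;> fin_cases j <;> simp [mkSL]
  have h2 := mkP_mul (-1) 0 0 (-1) a b c d (by ring) h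
  rw [h1, one_mul] at h2
  rw [h2]
  apply mkP_congr <;> ring

lemma mkP_congr_neg {a b c d a' b' c' d' : F} (h : a * d - b * c = 1) (h' : a' * d' - b' * c' = 1)
    (ha : a = -a') (hb : b = -b') (hc : c = -c') (hd : d = -d') :
    mkP a b c d h = mkP a' b' c' d' h' := by
  subst ha hb hc hd; exact mkP_neg _ _ _ _ h'

variable (F) in
def wP : PG F := mkP 0 (-1) 1 0 (by ring)

def bP (m n : F) (h : m ^ 2 + n ^ 2 = -1) : PG F := mkP m n n (-m) (by linear_combination -h)

lemma wP_sq : wP F * wP F = 1 := by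
  rw [wP, mkP_mul, ← mkP_one (by ring)]
  apply mkP_congr_neg <;> ring

lemma bP_sq (m n : F) (h : m ^ 2 + n ^ 2 = -1) : bP m n h * bP m n h = 1 := by
  rw [bP, mkP_mul, ← mkP_one (by ring)]
  apply mkP_congr_neg <;> first | ring1 | linear_combination h

lemma bP_wP (m n : F) (h : m ^ 2 + n ^ 2 = -1) : bP m n h * wP F = wP F * bP m n h := by
  rw [bP, wP, mkP_mul, mkP_mul]
  apply mkP_congr_neg <;> ring

end elts

section pts
variable {F : Type*} [Field F] [DecidableEq F]

/-- projective point from coordinates -/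
def mkPt (p r : F) : Option F := if r = 0 then none else some (p / r)

/-- Moebius action -/
def act (g : Matrix.SpecialLinearGroup (Fin 2) F) : Option F → Option F
  | none => mkPt (g 0 0) (g 1 0)
  | some x => mkPt (g 0 0 * x + g 0 1) (g 1 0 * x + g 1 1)

def negP : Option F → Option F := Option.map (fun x => -x)

lemma negP_act (a b c d : F) (h : a * d - b * c = 1) (P : Option F) :
    negP (act (mkSL a b c d h) P) = act (mkSL a (-b) (-c) d (by linear_combination h)) (negP P) := by
  cases P with
  | none =>
    by_cases hc : c = 0 <;> simp [act, mkPt, negP, hc]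
    rw [div_neg]
  | some x =>
    by_cases hc : c * x + d = 0 <;> simp [act, mkPt, negP, hc]
    rw [neg_add_eq_sub, ← neg_div]; congr 1; ring

lemma act_ne [Fintype F] [hq : Fact (Fintype.card F % 8 = 7)] (a b c d : F) (h : a * d - b * c = 1)
    (ht : d = -a) (P : Option F) : act (mkSL a b c d h) P ≠ P := by
  subst ht
  have hn := neg_one_nonsq (F := F)
  cases P with
  | none =>
    by_cases hc : c = 0
    · exact fun _ => hn ⟨a, by subst hc; linear_combination h⟩
    · simp [act, mkPt, hc]
  | some x =>
    by_cases hc : c * x + -a = 0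
    · simp [act, mkPt, hc]
    · simp only [act, mkPt, mkSL_00, mkSL_01, mkSL_10, mkSL_11, hc, if_false]
      intro he
      have he := Option.some_injective _ he
      rw [div_eq_iff hc] at he
      exact hn ⟨c * x - a, by linear_combination c * he + h⟩

end pts

section main
variable {F k : Type*} [Field F] [Fintype F] [DecidableEq F] [hq : Fact (Fintype.card F % 8 = 7)]
  [Field k] [CharP k 2] (ψ : AddChar F k) [hψ : Fact (ψ ≠ 1)]

/-- `E_P` -/
def EP : Option F → Vp F k
  | none => ⟨EE ψ 1 0, EE_mem ψ 1 0⟩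
  | some x => ⟨EE ψ x 1, EE_mem ψ x 1⟩

lemma EP_mkPt (p r : F) (h : p ≠ 0 ∨ r ≠ 0) : (EP ψ (mkPt p r)).1 = EE ψ p r := by
  by_cases hr : r = 0
  · subst hr; simp [mkPt, EP, EE_zero]
  · simp only [mkPt, hr, if_false, EP]
    have := EE_smul ψ r (p / r) 1 hr
    rw [← this]; congr 1 <;> field_simp

lemma weil_EP (g : Matrix.SpecialLinearGroup (Fin 2) F) (P : Option F) :
    weil ψ (g : PG F) (EP ψ P) = EP ψ (act g P) := by
  apply Subtype.ext
  rw [weil_coe]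
  cases P with
  | none =>
    have h : (1 : F) ≠ 0 ∨ (0 : F) ≠ 0 := Or.inl one_ne_zero
    have := mulvec_ne g _ _ h
    simp only [mul_one, mul_zero, add_zero] at this
    rw [act, EP_mkPt _ _ _ this, EP, om_EE _ _ _ _ h]; simp
  | some x =>
    have h : (x : F) ≠ 0 ∨ (1 : F) ≠ 0 := Or.inr one_ne_zero
    have := mulvec_ne g _ _ h
    simp only [mul_one] at this
    rw [act, EP_mkPt _ _ _ this, EP, om_EE _ _ _ _ h]; simp

/-- pairing map -/
def J : (Option F → k) →ₗ[k] (Vp F k × Vp F k) :=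
  (Fintype.linearCombination k (EP ψ)).prod (Fintype.linearCombination k (fun P => EP ψ (negP P)))

lemma J_ker (c : Option F → k) (hc : J ψ c = 0) (P : Option F) : c P = c none := by
  have h1 : Fintype.linearCombination k (EP ψ) c = 0 := congrArg Prod.fst hc
  have h2 : Fintype.linearCombination k (fun P => EP ψ (negP P)) c = 0 := congrArg Prod.snd hc
  rw [Fintype.linearCombination_apply, Fintype.sum_option] at h1 h2
  have g1 : ∀ y, c none * (Pi.single 0 1 : F → k) y + ∑ x, c (some x) * ψ (x * y ^ 2) = 0 := by
    intro y
    have := congrFun (congrArg Subtype.val h1) y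
    simpa [EP, EE_zero, EE_ne] using this
  have g2 : ∀ y, c none * (Pi.single 0 1 : F → k) y + ∑ x, c (some x) * ψ (x * -y ^ 2) = 0 := by
    intro y
    have := congrFun (congrArg Subtype.val h2) y
    simpa [EP, negP, EE_zero, EE_ne] using this
  have g3 : ∀ z, z ≠ 0 → ∑ x, c (some x) * ψ (x * z) = 0 := by
    intro z hz
    rcases sq_or z with ⟨y, hy⟩ | ⟨y, hy⟩
    · have hy0 : y ≠ 0 := by rintro rfl; simp at hy; exact hz hy
      have := g1 y
      rw [show z = y ^ 2 by rw [hy]; ring]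
      simpa [hy0] using this
    · have hy0 : y ≠ 0 := by rintro rfl; simp at hy; exact hz hy
      have := g2 y
      rw [show z = -y ^ 2 by linear_combination -hy]
      simpa [hy0] using this
  have g0 : ∑ x, c (some x) = c none := by
    have := g1 0
    simp at this
    rw [add_comm] at this
    rw [← CharTwo.neg_eq (c none)]
    exact eq_neg_of_add_eq_zero_left this
  cases P with
  | none => rfl
  | some x0 =>
    have e1 : ∑ z, (∑ x, c (some x) * ψ (x * z)) * ψ (-(x0 * z)) = c none := by
      rw [sum_eq_single 0]
      · simp [g0]
      · intro z _ hz; rw [g3 z hz, zero_mul]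
      · simp
    rw [← e1]
    simp_rw [sum_mul, mul_assoc, ← AddChar.map_add_eq_mul]
    rw [sum_comm]
    simp_rw [← mul_sum, ← neg_mul, ← add_mul]
    simp_rw [sum_psi']
    rw [sum_eq_single x0]
    · simp
    · intro b _ hb
      rw [if_neg, mul_zero]
      rw [← sub_eq_add_neg]; exact sub_ne_zero.2 hb
    · simp

lemma EP_inj : Function.Injective (EP ψ) := by
  intro P Q h
  have key : ∀ P Q, EP ψ P = EP ψ Q → EP ψ (negP P) = EP ψ (negP Q) := by
    intro P Q h
    cases P with
    | none =>
      cases Q with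
      | none => rfl
      | some x =>
        exfalso
        have := congrFun (congrArg Subtype.val h) 1
        simp [EP, EE_zero, EE_ne] at this
        have h2 := AddChar.map_add_eq_mul ψ x (-x)
        rw [← this] at h2
        simp at h2
    | some y =>
      cases Q with
      | none =>
        exfalso
        have := congrFun (congrArg Subtype.val h) 1
        simp [EP, EE_zero, EE_ne] at this
        have h2 := AddChar.map_add_eq_mul ψ y (-y)
        rw [this] at h2
        simp at h2
      | some x =>
        apply Subtype.ext
        ext z
        have := congrFun (congrArg Subtype.val h) z
        simp [EP, EE_ne] at this
        simp [EP, EE_ne, negP, AddChar.map_neg_eq_inv, this]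
  have hJ : J ψ (Pi.single P 1 + Pi.single Q 1) = 0 := by
    rw [map_add]
    apply Prod.ext <;> simp [J, Fintype.linearCombination_apply_single, h, key P Q h] <;>
      exact V4.add_self2 (k := k) _
  by_contra hne
  have hc : 2 < Fintype.card (Option F) := by
    rw [Fintype.card_option]; have := hq.out; omega
  obtain ⟨R, -, hR⟩ := Finset.exists_mem_notMem_of_card_lt_card
    (s := {P, Q}) (t := univ) ((card_le_two).trans_lt hc)
  simp only [mem_insert, mem_singleton, not_or] at hR
  obtain ⟨hR1, hR2⟩ := hR
  have a1 := J_ker ψ _ hJ P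
  have a2 := J_ker ψ _ hJ R
  rw [← a2] at a1
  simp [hne, hR1, hR2, Ne.symm hne] at a1

lemma act_mul_of (ψ : AddChar F k) [hψ : Fact (ψ ≠ 1)] {g h g' h' : Matrix.SpecialLinearGroup (Fin 2) F}
    (e : (g : PG F) * (h : PG F) = (g' : PG F) * (h' : PG F))
    (P : Option F) : act g (act h P) = act g' (act h' P) := by
  apply EP_inj ψ
  rw [← weil_EP, ← weil_EP, ← weil_EP, ← weil_EP, ← Module.End.mul_apply, ← map_mul, e, map_mul]
  rfl

lemma act_sq_of (ψ : AddChar F k) [hψ : Fact (ψ ≠ 1)] {g : Matrix.SpecialLinearGroup (Fin 2) F} (e : (g : PG F) * (g : PG F) = 1)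
    (P : Option F) : act g (act g P) = P := by
  apply EP_inj ψ
  rw [← weil_EP, ← weil_EP, ← Module.End.mul_apply, ← map_mul, e, map_one]
  rfl

lemma lin_eqv {k X Ω : Type*} [Field k] [AddCommGroup X] [Module k X] [Fintype Ω] (Q : V4 k X)
    (α β : Ω → Ω) (haa : ∀ x, α (α x) = x) (hbb : ∀ x, β (β x) = x)
    (hab : ∀ x, α (β x) = β (α x)) (e : Ω → X) (ha : ∀ P, Q.a (e P) = e (α P))
    (hb : ∀ P, Q.b (e P) = e (β P)) :
    V4.Eqv (permV4 k α β haa hbb hab) Q (Fintype.linearCombination k e) := by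
  constructor
  · intro c
    simp only [Fintype.linearCombination_apply, map_sum, map_smul, ha, permV4,
      LinearMap.funLeft_apply]
    rw [← Equiv.sum_comp ⟨α, α, haa, haa⟩]
    simp [haa]
  · intro c
    simp only [Fintype.linearCombination_apply, map_sum, map_smul, hb, permV4,
      LinearMap.funLeft_apply]
    rw [← Equiv.sum_comp ⟨β, β, hbb, hbb⟩]
    simp [hbb]

/-- the Klein four module on even functions -/
def VV (m n : F) (h : m ^ 2 + n ^ 2 = -1) : V4 k (Vp F k) :=
  repV4 (weil ψ) (wP F) (bP m n h) wP_sq (bP_sq m n h) (bP_wP m n h)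

lemma exists_hig : ∃ (m n : F) (h : m ^ 2 + n ^ 2 = -1), n ≠ 0 ∧ (VV ψ m n h).Hig := by
  obtain ⟨m, n, hm, hn, h⟩ := exists_mn F
  have h' : m ^ 2 + (-n) ^ 2 = -1 := by linear_combination h
  have hb0 : m * (-m) - n * n = 1 := by linear_combination -h
  have hb0' : m * (-m) - (-n) * (-n) = 1 := by linear_combination -h
  have hw0 : (0 : F) * 0 - (-1) * 1 = 1 := by ring
  set w := mkSL (0 : F) (-1) 1 0 hw0 with hw
  set b := mkSL m n n (-m) hb0 with hb
  set b' := mkSL m (-n) (-n) (-m) hb0' with hb'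
  have haa : ∀ P, act w (act w P) = P := act_sq_of ψ wP_sq
  have hbb : ∀ P, act b (act b P) = P := act_sq_of ψ (bP_sq m n h)
  have hab : ∀ P, act w (act b P) = act b (act w P) := act_mul_of ψ (bP_wP m n h).symm
  have fab : ∀ P, act w (act b P) ≠ P := by
    intro P
    have hc : (-n) * n - m * m = 1 := by linear_combination -h
    have : act w (act b P) = act (mkSL (-n) m m n hc) (act 1 P) := by
      apply act_mul_of ψ
      have := mkP_mul 0 (-1) 1 0 m n n (-m) hw0 hb0
      rw [QuotientGroup.mk_one, mul_one]
      refine this.trans ?_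
      apply mkP_congr <;> ring
    have h1 : act (1 : Matrix.SpecialLinearGroup (Fin 2) F) P = P := by
      cases P <;> simp [act, mkPt]
    rw [this, h1]
    exact act_ne _ _ _ _ hc (by ring) P
  have hΩ := permV4_hig (k := k) (act w) (act b) haa hbb hab (act_ne _ _ _ _ hw0 (by ring))
    (act_ne _ _ _ _ hb0 rfl) fab
  set Q := permV4 k (act w) (act b) haa hbb hab with hQ
  have e1 : V4.Eqv Q (VV ψ m n h) (Fintype.linearCombination k (EP ψ)) :=
    lin_eqv _ _ _ _ _ _ _ (fun P => weil_EP ψ w P) (fun P => weil_EP ψ b P)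
  have e2 : V4.Eqv Q (VV ψ m (-n) h') (Fintype.linearCombination k (fun P => EP ψ (negP P))) := by
    refine lin_eqv _ _ _ _ _ _ _ (fun P => ?_) (fun P => ?_)
    · have : wP F = (mkSL (0 : F) (-(-1)) (-1) 0 (by ring) : Matrix.SpecialLinearGroup (Fin 2) F) := by
        apply mkP_congr_neg <;> ring
      rw [hw, negP_act, ← weil_EP, ← this]; rfl
    · rw [hb, negP_act, ← weil_EP]; rfl
  have hr := hΩ.finrank_eq
  rw [finrank_fintype_fun_eq_card, Fintype.card_option] at hr
  have hle := finrank_prod_le (LinearMap.range (VV ψ m n h).s) (LinearMap.range (VV ψ m (-n) h').s)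
    ((LinearMap.range Q.s).map (J ψ)) (by
    rintro _ ⟨_, ⟨c, rfl⟩, rfl⟩
    refine ⟨⟨Fintype.linearCombination k (EP ψ) c, ?_⟩,
      ⟨Fintype.linearCombination k (fun P => EP ψ (negP P)) c, ?_⟩⟩
    · simp [J, V4.s_apply, e1.1, e1.2]
    · simp [J, V4.s_apply, e2.1, e2.2])
  have hker : finrank k (LinearMap.range Q.s ⊓ LinearMap.ker (J ψ) : Submodule k (Option F → k)) ≤ 1 := by
    refine (Submodule.finrank_mono (t := k ∙ (fun _ => (1 : k))) ?_).trans ((finrank_span_le_card _).trans (by simp))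
    rintro c ⟨-, hc⟩
    rw [Submodule.mem_span_singleton]
    refine ⟨c none, ?_⟩
    ext P
    simp [J_ker ψ c hc P]
  have hsum := finrank_map_inf (J ψ) (LinearMap.range Q.s)
  have hdim := finrank_Vp F k
  have hcard := card_SS (F := F)
  have f1 := V4.four_le (VV ψ m n h)
  have f2 := V4.four_le (VV ψ m (-n) h')
  have hq' := hq.out
  by_cases hh : finrank k (Vp F k) ≤ 4 * finrank k (LinearMap.range (VV ψ m n h).s)
  · exact ⟨m, n, h, hn, V4.hig_of_finrank _ hh⟩
  · refine ⟨m, -n, h', neg_ne_zero.2 hn, V4.hig_of_finrank _ ?_⟩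
    omega

end main
end PSLNA


namespace PSLNA

set_option linter.unusedSectionVars false
set_option linter.unusedDecidableInType false

open Module Finset

section nt
variable {F k : Type*} [Field F] [Fintype F] [DecidableEq F] [hq : Fact (Fintype.card F % 8 = 7)]
  [Field k] [CharP k 2] (ψ : AddChar F k) [hψ : Fact (ψ ≠ 1)]

lemma fourier_inv (g : F → k) (y : F) : ∑ t, (∑ z, g z * ψ (-(t * z))) * ψ (t * y) = g y := by
  simp_rw [sum_mul, mul_assoc, ← AddChar.map_add_eq_mul]
  rw [sum_comm]
  simp_rw [← mul_sum, ← mul_neg, ← mul_add]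
  simp_rw [sum_psi]
  rw [sum_eq_single y]
  · simp
  · intro b _ hb
    rw [if_neg, mul_zero]
    rw [neg_add_eq_sub]; exact sub_ne_zero.2 hb.symm
  · simp

lemma exists_rho (t : F) : ∃ r : F, r ≠ 0 ∧ IsSquare (-(r ^ 2 - t * r + 1)) := by
  have h2 := two_ne (F := F)
  suffices h : ∃ r : F, IsSquare (-(r ^ 2 - t * r + 1)) by
    obtain ⟨r, hr⟩ := h
    refine ⟨r, ?_, hr⟩
    rintro rfl
    apply neg_one_nonsq (F := F)
    simpa using hr
  rcases sq_or (1 - t ^ 2 / 4) with ⟨e, he⟩ | h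
  · obtain ⟨m, n, hm, hn, hmn⟩ := exists_mn F
    have h4 := four_ne (F := F)
    refine ⟨t / 2 + m * e / n, e / n, ?_⟩
    field_simp
    field_simp at he
    linear_combination (-4 * e ^ 2) * hmn - n ^ 2 * he
  · refine ⟨t / 2, ?_⟩
    convert h using 2
    have h4 := four_ne (F := F)
    field_simp; ring

/-- determination of the Bessel function -/
lemma bessel (h : F → k) (h0 : h 0 = 0) (heven : ∀ y, h (-y) = h y)
    (R : ∀ α ∈ SS F, ∀ x, ∑ z ∈ SS F, ψ (x * z ^ 2) * h z * h (α * z) =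
      if x = 0 then (if α = 1 then 1 else 0) else ψ (-((α ^ 2 + 1) / x)) * h (α / x)) (y : F) :
    h y = ψ (2 * y) + ψ (-(2 * y)) := by
  have h2 := two_ne (F := F)
  have h4 := four_ne (F := F)
  set d : F → k := fun t => ∑ z, h z * ψ (-(t * z)) with hd
  have deven : ∀ t, d (-t) = d t := by
    intro t
    simp only [hd]
    rw [← Equiv.sum_comp (Equiv.neg F)]
    simp [heven]
  -- Fourier transform of the relation
  have key : ∀ ρ ∈ SS F, ∀ β : F,
      ∑ y, h y * ψ (-((ρ + 1 / ρ) * y) + β ^ 2 / y) = if ρ = 1 then 1 else 0 := by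
    intro ρ hρ β
    have hρ0 := (mem_SS.1 hρ).1
    set b := - β ^ 2 / ρ with hb
    have e1 : ∑ x, ψ (-(x * b)) * ∑ z ∈ SS F, ψ (x * z ^ 2) * h z * h (ρ * z) = 0 := by
      simp_rw [mul_sum]
      rw [sum_comm]
      apply sum_eq_zero
      intro z hz
      have hz0 := (mem_SS.1 hz).1
      have : ∀ x, ψ (-(x * b)) * (ψ (x * z ^ 2) * h z * h (ρ * z)) =
          ψ (x * (z ^ 2 - b)) * (h z * h (ρ * z)) := by
        intro x
        rw [mul_assoc (ψ _), ← mul_assoc (ψ _), ← AddChar.map_add_eq_mul]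
        congr 2; ring
      simp_rw [this]
      rw [← sum_mul, sum_psi, if_neg, zero_mul]
      intro hzb
      have hsq : IsSquare (-1 : F) := by
        have hβ : β ≠ 0 := by
          rintro rfl
          simp [hb] at hzb
          exact hz0 hzb
        obtain ⟨σ, hσ⟩ := (mem_SS.1 hρ).2
        have : (-1 : F) = (σ * z / β) * (σ * z / β) := by
          have : ρ * z ^ 2 = - β ^ 2 := by
            rw [sub_eq_zero.1 hzb, hb]; field_simp
          field_simp
          rw [← this, hσ]; ring
        exact ⟨_, this⟩
      exact neg_one_nonsq hsq
    simp_rw [R ρ hρ] at e1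
    have e2 : ∀ x, ψ (-(x * b)) * (if x = 0 then (if ρ = 1 then (1 : k) else 0) else
        ψ (-((ρ ^ 2 + 1) / x)) * h (ρ / x)) = (if x = 0 then (if ρ = 1 then (1 : k) else 0) else 0) +
        h (ρ / x) * ψ (-((ρ + 1 / ρ) * (ρ / x)) + β ^ 2 / (ρ / x)) := by
      intro x
      by_cases hx : x = 0
      · subst hx; simp [h0]
      · simp only [hx, if_false, zero_add]
        rw [← mul_assoc, ← AddChar.map_add_eq_mul, mul_comm]
        congr 2
        rw [hb]; field_simp; ring
    simp_rw [e2] at e1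
    rw [sum_add_distrib, sum_ite_eq' univ (0 : F)] at e1
    simp only [mem_univ, if_true] at e1
    have inv : Function.Involutive (fun x : F => ρ / x) := fun x => by
      by_cases hx : x = 0
      · simp [hx]
      · simp only; field_simp
    have e3 := Equiv.sum_comp inv.toPerm
      (fun y => h y * ψ (-((ρ + 1 / ρ) * y) + β ^ 2 / y))
    simp only [Function.Involutive.coe_toPerm] at e3
    rw [e3] at e1
    rw [← CharTwo.neg_eq (if ρ = 1 then (1 : k) else 0)]
    exact eq_neg_of_add_eq_zero_right e1
  have key2 : ∀ ρ ∈ SS F, ∀ β : F,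
      ∑ γ, d (ρ + 1 / ρ + γ ^ 2) * ψ (2 * β * γ) = if ρ = 1 then 1 else 0 := by
    intro ρ hρ β
    rw [← key ρ hρ β]
    simp only [hd, sum_mul]
    rw [sum_comm]
    refine sum_congr rfl fun z _ => ?_
    by_cases hz : z = 0
    · simp [hz, h0]
    · have := gauss ψ (-z) (2 * β) (neg_ne_zero.2 hz)
      rw [AddChar.map_add_eq_mul, ← mul_assoc]
      have e : -((2 * β) ^ 2 / (4 * -z)) = β ^ 2 / z := by field_simp; ring
      rw [e] at this
      rw [← this, mul_sum]
      refine sum_congr rfl fun γ _ => ?_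
      rw [mul_assoc (h z), mul_assoc (h z), ← AddChar.map_add_eq_mul, ← AddChar.map_add_eq_mul]
      congr 2; ring
  have key3 : ∀ ρ ∈ SS F, ∀ γ : F, d (ρ + 1 / ρ + γ ^ 2) = if ρ = 1 ∧ γ = 0 then 1 else 0 := by
    intro ρ hρ γ
    have := fourier_inv ψ (fun γ => d (ρ + 1 / ρ + γ ^ 2)) γ
    rw [← this]
    have e : ∀ t, ∑ z, d (ρ + 1 / ρ + z ^ 2) * ψ (-(t * z)) = if ρ = 1 then 1 else 0 := by
      intro t
      rw [← key2 ρ hρ (-t / 2)]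
      refine sum_congr rfl fun z _ => ?_
      congr 2; field_simp
    simp_rw [e]
    rw [← mul_sum, sum_psi]
    by_cases h1 : ρ = 1 <;> by_cases h3 : γ = 0 <;> simp [h1, h3]
  have one_mem : (1 : F) ∈ SS F := mem_SS.2 ⟨one_ne_zero, ⟨1, by simp⟩⟩
  have d2 : d 2 = 1 := by
    have := key3 1 one_mem 0
    simpa [one_add_one_eq_two] using this
  have dz : ∀ t, t ≠ 2 → t ≠ -2 → d t = 0 := by
    intro t ht ht'
    obtain ⟨r, hr, γ, hγ⟩ := exists_rho t
    rcases sq_or r with hs | hs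
    · have hmem : r ∈ SS F := mem_SS.2 ⟨hr, hs⟩
      obtain ⟨σ, hσ⟩ := hs
      have hσ0 : σ ≠ 0 := by rintro rfl; simp at hσ; exact hr hσ
      have e : t = r + 1 / r + (γ / σ) ^ 2 := by
        rw [div_pow, pow_two σ, ← hσ]
        field_simp
        linear_combination hγ
      rw [e, key3 r hmem, if_neg]
      rintro ⟨rfl, hh⟩
      apply ht
      rw [e, hh]; norm_num
    · have hmem : -r ∈ SS F := mem_SS.2 ⟨neg_ne_zero.2 hr, hs⟩
      obtain ⟨σ, hσ⟩ := hs
      have hσ0 : σ ≠ 0 := by rintro rfl; simp at hσ; exact hr hσ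
      have e : -t = -r + 1 / -r + (γ / σ) ^ 2 := by
        rw [div_pow, pow_two σ, ← hσ]
        field_simp
        linear_combination -hγ
      rw [← deven, e, key3 (-r) hmem, if_neg]
      rintro ⟨hh1, hh⟩
      apply ht'
      rw [hh1, hh] at e
      linear_combination -e
  have := fourier_inv ψ h y
  rw [← this]
  have hne : (2 : F) ≠ -2 := fun h => h4 (by linear_combination h)
  change ∑ t, d t * ψ (t * y) = _
  rw [← sum_subset (subset_univ {2, -2}), sum_pair hne, deven, d2]
  · simp
  · intro t _ ht
    simp only [mem_insert, mem_singleton, not_or] at ht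
    rw [dz t ht.1 ht.2, zero_mul]

end nt
end PSLNA


namespace PSLNA

set_option linter.unusedSectionVars false
set_option linter.unusedDecidableInType false

open Module Finset

section rel
variable {F : Type*} [Field F] [DecidableEq F]

def uP (x : F) : PG F := mkP 1 x 0 1 (by ring)

def tt (c : F) : PG F := if h : c ≠ 0 then mkP c 0 0 c⁻¹ (by simp [h]) else 1

lemma tt_ne {c : F} (h : c ≠ 0) : tt c = mkP c 0 0 c⁻¹ (by simp [h]) := dif_pos h

lemma uP_add (x y : F) : uP x * uP y = uP (x + y) := by
  rw [uP, uP, uP, mkP_mul]; apply mkP_congr <;> ring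

lemma uP_zero : uP (0 : F) = 1 := by rw [uP, mkP_one]

lemma tt_one : tt (1 : F) = 1 := by
  rw [tt_ne one_ne_zero, ← mkP_one (by ring)]; apply mkP_congr <;> simp

lemma tt_mul {c d : F} (hc : c ≠ 0) (hd : d ≠ 0) : tt c * tt d = tt (c * d) := by
  rw [tt_ne hc, tt_ne hd, tt_ne (mul_ne_zero hc hd), mkP_mul]
  apply mkP_congr <;> simp [mul_comm]

lemma tt_neg (c : F) : tt (-c) = tt c := by
  by_cases hc : c = 0
  · simp [hc]
  · rw [tt_ne hc, tt_ne (neg_ne_zero.2 hc)]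
    apply mkP_congr_neg <;> first | rfl | simp

lemma u_tt {c : F} (hc : c ≠ 0) (x : F) : uP x * tt c = tt c * uP (x / c ^ 2) := by
  rw [tt_ne hc, uP, uP, mkP_mul, mkP_mul]
  apply mkP_congr <;> field_simp <;> ring

lemma tt_w {c : F} (hc : c ≠ 0) : tt c * wP F = wP F * tt c⁻¹ := by
  rw [tt_ne hc, tt_ne (inv_ne_zero hc), wP, mkP_mul, mkP_mul]
  apply mkP_congr <;> simp

lemma mkP_dec (a b c d : F) (h : a * d - b * c = 1) (hc : c ≠ 0) :
    mkP a b c d h = uP (a / c) * tt (1 / c) * wP F * uP (d / c) := by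
  rw [tt_ne (one_div_ne_zero hc), wP, uP, uP, mkP_mul, mkP_mul, mkP_mul]
  apply mkP_congr
  · field_simp; ring
  · field_simp; linear_combination -c * h
  · field_simp; ring
  · field_simp; ring

lemma mkP_dec0 (a b d : F) (h : a * d - b * 0 = 1) :
    mkP a b 0 d h = uP (a * b) * tt a := by
  have ha : a ≠ 0 := by rintro rfl; simp at h
  have hd : d = a⁻¹ := by field_simp; linear_combination h
  subst hd
  rw [tt_ne ha, uP, mkP_mul]
  apply mkP_congr <;> field_simp <;> ring

lemma wuw {x : F} (hx : x ≠ 0) :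
    wP F * uP x * wP F = uP (-1 / x) * tt (1 / x) * wP F * uP (-1 / x) := by
  rw [← mkP_dec (-1) 0 x (-1) (by ring) hx]
  rw [wP, uP, mkP_mul, mkP_mul]
  apply mkP_congr <;> ring

lemma PG_ind (P : PG F → Prop) (h : ∀ a b c d h, P (mkP a b c d h)) (g : PG F) : P g := by
  induction g using QuotientGroup.induction_on with
  | H g =>
    have hd : g 0 0 * g 1 1 - g 0 1 * g 1 0 = 1 := by
      rw [← Matrix.det_fin_two]; exact g.2
    have := h (g 0 0) (g 0 1) (g 1 0) (g 1 1) hd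
    unfold mkP at this
    convert this using 2
    ext i j
    fin_cases i <;> fin_cases j <;> rfl

end rel

section uniq
variable {F k X : Type*} [Field F] [Fintype F] [DecidableEq F] [hq : Fact (Fintype.card F % 8 = 7)]
  [Field k] [CharP k 2] [AddCommGroup X] [Module k X] [FiniteDimensional k X]

lemma rmul (ρ : PG F →* (X →ₗ[k] X)) (g h : PG F) (m : X) : ρ (g * h) m = ρ g (ρ h m) := by
  rw [map_mul]; rfl

lemma exists_psi (ρ : PG F →* (X →ₗ[k] X)) (hdim : finrank k X = (SS F).card)
    (irr : ∀ p : Submodule k X, (∀ g, ∀ x ∈ p, ρ g x ∈ p) → p = ⊥ ∨ p = ⊤)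
    (ψ : AddChar F k) [hψ : Fact (ψ ≠ 1)] :
    ∃ χ : AddChar F k, χ ≠ 1 ∧ ∃ v : X, v ≠ 0 ∧ ∀ x, ρ (uP x) v = χ x • v := by
  by_contra! hcon
  let e : F → X → X := fun a m => ∑ x, ψ (-(a * x)) • ρ (uP x) m
  have heig : ∀ a m y, ρ (uP y) (e a m) = ψ (a * y) • e a m := by
    intro a m y
    simp only [e, map_sum, map_smul, smul_sum, smul_smul, ← rmul, uP_add, ← AddChar.map_add_eq_mul]
    rw [← Equiv.sum_comp (Equiv.addLeft y) (fun x => ψ (a * y + -(a * x)) • ρ (uP x) m)]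
    refine sum_congr rfl fun x _ => ?_
    simp only [Equiv.coe_addLeft]
    congr 2; ring
  have hsum : ∀ m, ∑ a, e a m = m := by
    intro m
    simp only [e]
    rw [sum_comm]
    simp_rw [← sum_smul, ← mul_neg, sum_psi]
    simp [uP_zero]
  have hz : ∀ a, a ≠ 0 → ∀ m, e a m = 0 := by
    intro a ha m
    by_contra hne
    refine hcon (AddChar.mulShift ψ a) ?_ (e a m) hne |>.elim fun x hx => hx ?_
    · exact AddChar.IsPrimitive.of_ne_one hψ.out ha
    · rw [heig, AddChar.mulShift_apply]
  have hu : ∀ x m, ρ (uP x) m = m := by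
    intro x m
    have h1 : e 0 m = m := by
      refine Eq.trans ?_ (hsum m)
      rw [sum_eq_single 0]
      · intro b _ hb; exact hz b hb m
      · simp
    rw [← h1, heig]; simp
  have hw2 : ∀ m, ρ (wP F) (ρ (wP F) m) = m := by
    intro m; rw [← rmul, wP_sq, map_one]; rfl
  have hrel : ∀ x : F, x ≠ 0 → ∀ m, m = ρ (tt (1 / x)) (ρ (wP F) m) := by
    intro x hx m
    have := congrArg (fun g => ρ g m) (wuw hx)
    simpa only [rmul, hu, hw2] using this
  have hw : ∀ m, ρ (wP F) m = m := by
    intro m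
    have := hrel 1 one_ne_zero m
    rw [div_one, tt_one, map_one] at this
    exact this.symm
  have ht : ∀ c m, ρ (tt c) m = m := by
    intro c m
    by_cases hc : c = 0
    · simp [tt, hc]
    · have := hrel (1 / c) (one_div_ne_zero hc) m
      rw [hw, one_div_one_div] at this
      exact this.symm
  have hall : ∀ g m, ρ g m = m := by
    intro g m
    refine PG_ind (fun g => ρ g m = m) (fun a b c d h => ?_) g
    by_cases hc : c = 0
    · subst hc
      rw [mkP_dec0]; simp only [rmul, hu, ht]
    · rw [mkP_dec _ _ _ _ _ hc]; simp only [rmul, hu, ht, hw]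
  have hcard := card_SS (F := F)
  have hqq := hq.out
  have h3 : 3 ≤ finrank k X := by rw [hdim]; omega
  have : Nontrivial X := nontrivial_of_finrank_pos (R := k) (by omega)
  obtain ⟨v, hv⟩ := exists_ne (0 : X)
  have h1 := finrank_span_singleton (K := k) hv
  rcases irr (k ∙ v) (fun g x hx => by rw [hall]; exact hx) with h | h
  · rw [h, finrank_bot] at h1; omega
  · rw [h, finrank_top] at h1; omega

end uniq
end PSLNA


namespace PSLNA

set_option linter.unusedSectionVars false
set_option linter.unusedDecidableInType false

open Module Finset

section uniq
variable {F k X : Type*} [Field F] [Fintype F] [DecidableEq F] [hq : Fact (Fintype.card F % 8 = 7)]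
  [Field k] [CharP k 2] [AddCommGroup X] [Module k X] [FiniteDimensional k X]

lemma SS_cases {y : F} (hy : y ≠ 0) : y ∈ SS F ∨ -y ∈ SS F := by
  by_cases h : y ∈ SS F
  · exact Or.inl h
  · exact Or.inr ((neg_mem_SS hy).2 h)

lemma one_mem_SS : (1 : F) ∈ SS F := mem_SS.2 ⟨one_ne_zero, ⟨1, by simp⟩⟩

lemma div_mem_SS {y z : F} (hy : y ∈ SS F) (hz : z ∈ SS F) : z / y ∈ SS F := by
  rw [mem_SS] at *
  exact ⟨div_ne_zero hz.1 hy.1, hz.2.div hy.2⟩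

variable (ρ : PG F →* (X →ₗ[k] X)) (ψ : AddChar F k) [hψ : Fact (ψ ≠ 1)]

def vz (v : X) (z : F) : X := ρ (tt z⁻¹) v

lemma vz_neg (v : X) (z : F) : vz ρ v (-z) = vz ρ v z := by
  have : (-z)⁻¹ = -z⁻¹ := inv_neg
  rw [vz, vz, this, tt_neg]

lemma vz_ne {v : X} (hv : v ≠ 0) {z : F} (hz : z ≠ 0) : vz ρ v z ≠ 0 := by
  intro h
  apply hv
  have h1 := congrArg (ρ (tt z)) h
  rw [vz, ← rmul, tt_mul hz (inv_ne_zero hz), mul_inv_cancel₀ hz, tt_one, map_one, map_zero] at h1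
  exact h1

lemma t_vz (v : X) {c z : F} (hc : c ≠ 0) (hz : z ≠ 0) : ρ (tt c) (vz ρ v z) = vz ρ v (z / c) := by
  rw [vz, vz, ← rmul, tt_mul hc (inv_ne_zero hz)]
  congr 3; field_simp

variable {ρ ψ}

lemma u_vz {v : X} (hu : ∀ x, ρ (uP x) v = ψ x • v) {z : F} (hz : z ≠ 0) (x : F) :
    ρ (uP x) (vz ρ v z) = ψ (x * z ^ 2) • vz ρ v z := by
  rw [vz, ← rmul, u_tt (inv_ne_zero hz), rmul, hu, map_smul]
  congr 2; field_simp

lemma vz_indep {v : X} (hv : v ≠ 0) (hu : ∀ x, ρ (uP x) v = ψ x • v) :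
    LinearIndependent k (fun z : SS F => vz ρ v z.1) := by
  rw [Fintype.linearIndependent_iff]
  intro g hg i
  have h1 : ∑ x, ψ (-(x * i.1 ^ 2)) • ρ (uP x) (∑ z : SS F, g z • vz ρ v z.1) = 0 := by
    rw [hg]; simp
  have h2 : ∀ z : SS F, ∀ x, ψ (-(x * i.1 ^ 2)) • ρ (uP x) (g z • vz ρ v z.1) =
      ψ (x * (z.1 ^ 2 - i.1 ^ 2)) • (g z • vz ρ v z.1) := by
    intro z x
    rw [map_smul, u_vz hu (mem_SS.1 z.2).1, smul_comm (g z), smul_smul, ← AddChar.map_add_eq_mul]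
    congr 2; ring
  simp_rw [map_sum, smul_sum, h2] at h1
  rw [sum_comm] at h1
  simp_rw [← sum_smul, sum_psi] at h1
  rw [sum_eq_single i] at h1
  · rw [sub_self, if_pos rfl, one_smul] at h1
    exact (smul_eq_zero.1 h1).resolve_right (vz_ne ρ hv (mem_SS.1 i.2).1)
  · intro z _ hz
    rw [if_neg, zero_smul]
    intro h
    exact hz (Subtype.ext (sq_inj z.2 i.2 (sub_eq_zero.1 h)))
  · simp

theorem uniq_aux {v : X} (hv : v ≠ 0) (hu : ∀ x, ρ (uP x) v = ψ x • v)
    (hdim : finrank k X = (SS F).card) :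
    ∃ Φ : X →ₗ[k] Vp F k, Function.Injective Φ ∧ LinearMap.range Φ = LinearMap.ker (ev0 F k) ∧
      (∀ x m, (Φ (ρ (uP x) m)).1 = opU ψ x (Φ m).1) ∧
      (∀ c, c ≠ 0 → ∀ m, (Φ (ρ (tt c) m)).1 = opT c (Φ m).1) ∧
      (∀ m, (Φ (ρ (wP F) m)).1 = opW ψ (Φ m).1) := by
  have : Nonempty (SS F) := ⟨⟨1, one_mem_SS⟩⟩
  let B : Basis (SS F) k X := basisOfLinearIndependentOfCardEqFinrank (vz_indep hv hu)
    (by rw [hdim, Fintype.card_coe])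
  have hB : ∀ z : SS F, B z = vz ρ v z.1 := fun z => by
    simp [B]
  let l : X →ₗ[k] k := B.coord ⟨1, one_mem_SS⟩
  have hl : ∀ z ∈ SS F, l (vz ρ v z) = if z = 1 then 1 else 0 := by
    intro z hz
    have := hB ⟨z, hz⟩
    simp only at this
    rw [← this]
    simp only [l, Basis.coord_apply, Basis.repr_self, Finsupp.single_apply, Subtype.mk.injEq]
  let Φ : X →ₗ[k] Vp F k :=
    { toFun := fun m => ⟨fun y => if y = 0 then 0 else l (ρ (tt y) m), fun y => by
        simp [tt_neg]⟩
      map_add' := fun m m' => by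
        apply Subtype.ext; ext y; by_cases hy : y = 0 <;> simp [hy]
      map_smul' := fun c m => by
        apply Subtype.ext; ext y; by_cases hy : y = 0 <;> simp [hy] }
  have Φ0 : ∀ m, (Φ m).1 0 = 0 := fun m => if_pos rfl
  have Φne : ∀ m y, y ≠ 0 → (Φ m).1 y = l (ρ (tt y) m) := fun m y hy => if_neg hy
  have Φ1 : ∀ m, (Φ m).1 1 = l m := fun m => by
    rw [Φne _ _ one_ne_zero, tt_one, map_one]; rfl
  have Φv : ∀ z ∈ SS F, ∀ y, (Φ (vz ρ v z)).1 y = (Pi.single z 1 + Pi.single (-z) 1 : F → k) y := by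
    intro z hz y
    have hz0 := (mem_SS.1 hz).1
    have h2 := two_ne (F := F)
    rw [Pi.add_apply, Pi.single_apply, Pi.single_apply]
    by_cases hy : y = 0
    · subst hy; rw [Φ0, if_neg hz0.symm, if_neg (neg_ne_zero.2 hz0).symm, add_zero]
    · rw [Φne _ _ hy, t_vz ρ v hy hz0]
      rcases SS_cases hy with hs | hs
      · rw [hl _ (div_mem_SS hs hz)]
        have : y ≠ -z := by
          rintro rfl
          exact (neg_mem_SS hz0).1 hs hz
        rw [if_neg this, add_zero]
        simp only [div_eq_one_iff_eq hy, eq_comm]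
      · have hd := div_mem_SS hs hz
        have e : z / y = -(z / -y) := by field_simp
        rw [e, vz_neg, hl _ hd]
        have : y ≠ z := by
          rintro rfl
          exact (neg_mem_SS hz0).1 hs hz
        rw [if_neg this, zero_add]
        simp only [div_eq_one_iff_eq (neg_ne_zero.2 hy)]
        congr 1
        exact propext ⟨fun h => by rw [h, neg_neg], fun h => by rw [h, neg_neg]⟩
  have Φt : ∀ c, c ≠ 0 → ∀ m, (Φ (ρ (tt c) m)).1 = opT c (Φ m).1 := by
    intro c hc m
    ext y
    rw [opT_apply]
    by_cases hy : y = 0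
    · subst hy; rw [mul_zero, Φ0, Φ0]
    · rw [Φne _ _ hy, Φne _ _ (mul_ne_zero hc hy), ← rmul, tt_mul hy hc, mul_comm]
  have Φu : ∀ x m, (Φ (ρ (uP x) m)).1 = opU ψ x (Φ m).1 := by
    intro x m
    have : (Vp F k).subtype ∘ₗ Φ ∘ₗ ρ (uP x) = opU ψ x ∘ₗ (Vp F k).subtype ∘ₗ Φ := by
      apply B.ext
      intro z
      have hz0 := (mem_SS.1 z.2).1
      ext y
      simp only [LinearMap.comp_apply, Submodule.subtype_apply, hB]
      rw [u_vz hu hz0, map_smul, opU_apply]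
      rw [Submodule.coe_smul, Pi.smul_apply, smul_eq_mul, Φv _ z.2]
      rw [Pi.add_apply, Pi.single_apply, Pi.single_apply]
      by_cases h1 : y = z.1
      · rw [h1]
      · by_cases h2 : y = -z.1
        · rw [h2, neg_sq]
        · simp [h1, h2]
    exact LinearMap.congr_fun this m
  have hexp : ∀ m, m = ∑ z ∈ SS F, (Φ m).1 z • vz ρ v z := by
    intro m
    let R : X →ₗ[k] X := ∑ z ∈ SS F, (LinearMap.proj z ∘ₗ (Vp F k).subtype ∘ₗ Φ).smulRight (vz ρ v z)
    have hR : ∀ m, R m = ∑ z ∈ SS F, (Φ m).1 z • vz ρ v z := fun m => by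
      simp [R, LinearMap.sum_apply]
    have : LinearMap.id = R := by
      apply B.ext
      intro z
      have hz0 := (mem_SS.1 z.2).1
      rw [hR, hB, sum_eq_single z.1]
      · rw [Φv _ z.2, Pi.add_apply, Pi.single_eq_same, Pi.single_eq_of_ne, add_zero, one_smul]
        · rfl
        · intro h
          exact (neg_mem_SS hz0).1 (h ▸ z.2) z.2
      · intro y hy hne
        rw [Φv _ z.2, Pi.add_apply, Pi.single_eq_of_ne hne, Pi.single_eq_of_ne, add_zero, zero_smul]
        rintro rfl
        exact (neg_mem_SS hz0).1 hy z.2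
      · intro h; exact absurd z.2 h
    rw [← hR, ← this]; rfl
  have hinj : Function.Injective Φ := by
    rw [injective_iff_map_eq_zero]
    intro m hm
    rw [hexp m, hm]; simp
  have hrange : LinearMap.range Φ = LinearMap.ker (ev0 F k) := by
    apply Submodule.eq_of_le_of_finrank_eq
    · rintro _ ⟨m, rfl⟩
      rw [LinearMap.mem_ker, ev0_apply, Φ0]
    · rw [LinearMap.finrank_range_of_inj hinj, finrank_ker_ev0, hdim]
  let h : F → k := fun y => if y = 0 then 0 else l (ρ (wP F) (vz ρ v y))
  have hh0 : h 0 = 0 := if_pos rfl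
  have hne : ∀ y, y ≠ 0 → h y = l (ρ (wP F) (vz ρ v y)) := fun y hy => if_neg hy
  have hev : ∀ y, h (-y) = h y := fun y => by simp [h, vz_neg]
  have hΦw : ∀ α ∈ SS F, ∀ y, (Φ (ρ (wP F) (vz ρ v α))).1 y = h (α * y) := by
    intro α hα y
    have hα0 := (mem_SS.1 hα).1
    by_cases hy : y = 0
    · subst hy; rw [Φ0, mul_zero, hh0]
    · rw [Φne _ _ hy, hne _ (mul_ne_zero hα0 hy), ← rmul, tt_w hy, rmul,
        t_vz ρ v (inv_ne_zero hy) hα0]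
      congr 3; field_simp
  have hlu : ∀ x m, l (ρ (uP x) m) = ψ x * l m := by
    intro x m
    rw [← Φ1, ← Φ1, Φu, opU_apply]; simp
  have hR : ∀ α ∈ SS F, ∀ x, ∑ z ∈ SS F, ψ (x * z ^ 2) * h z * h (α * z) =
      if x = 0 then (if α = 1 then 1 else 0) else ψ (-((α ^ 2 + 1) / x)) * h (α / x) := by
    intro α hα x
    have hα0 := (mem_SS.1 hα).1
    have e1 : l (ρ (wP F) (ρ (uP x) (ρ (wP F) (vz ρ v α)))) =
        ∑ z ∈ SS F, ψ (x * z ^ 2) * h z * h (α * z) := by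
      rw [hexp (ρ (wP F) (vz ρ v α))]
      simp only [map_sum, map_smul]
      refine sum_congr rfl fun z hz => ?_
      have hz0 := (mem_SS.1 hz).1
      rw [u_vz hu hz0, hΦw α hα, map_smul, map_smul, ← hne z hz0, smul_eq_mul, smul_eq_mul]
      ring
    rw [← e1]
    by_cases hx : x = 0
    · subst hx
      rw [if_pos rfl, uP_zero, map_one, Module.End.one_apply, ← rmul, wP_sq, map_one,
        Module.End.one_apply, hl α hα]
    · rw [if_neg hx, ← rmul, ← rmul, wuw hx, rmul, u_vz hu hα0, map_smul, map_smul,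
        mul_assoc, rmul, hlu, rmul, ← Φne _ _ (one_div_ne_zero hx), hΦw α hα, smul_eq_mul,
        ← mul_assoc, ← AddChar.map_add_eq_mul]
      congr 2
      · field_simp; ring
      · field_simp
  have hbes := bessel ψ h hh0 hev hR
  have Φw : ∀ m, (Φ (ρ (wP F) m)).1 = opW ψ (Φ m).1 := by
    intro m
    have : (Vp F k).subtype ∘ₗ Φ ∘ₗ ρ (wP F) = opW ψ ∘ₗ (Vp F k).subtype ∘ₗ Φ := by
      apply B.ext
      intro z
      have hz0 := (mem_SS.1 z.2).1
      ext y
      simp only [LinearMap.comp_apply, Submodule.subtype_apply, hB]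
      rw [hΦw _ z.2, opW_apply, hbes]
      simp_rw [Φv _ z.2, Pi.add_apply, mul_add]
      rw [sum_add_distrib]
      simp only [Pi.single_apply, mul_ite, mul_one, mul_zero, sum_ite_eq', mem_univ, if_true]
      rw [add_comm]
      congr 2 <;> ring
    exact LinearMap.congr_fun this m
  exact ⟨Φ, hinj, hrange, Φu, Φt, Φw⟩

end uniq
end PSLNA


namespace PSLNA

set_option linter.unusedSectionVars false
set_option linter.unusedDecidableInType false

open Module Finset

section uniq
variable {F k X : Type*} [Field F] [Fintype F] [DecidableEq F] [hq : Fact (Fintype.card F % 8 = 7)]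
  [Field k] [CharP k 2] [AddCommGroup X] [Module k X] [FiniteDimensional k X]

lemma weil_mkP_ne (ψ : AddChar F k) [Fact (ψ ≠ 1)] (a b c d : F) (h) (hc : c ≠ 0) (φ : Vp F k) :
    (weil ψ (mkP a b c d h) φ).1 =
      opU ψ (a / c) (opT (1 / c) (opW ψ (opU ψ (d / c) φ.1))) := by
  rw [mkP, weil_coe, om]
  simp [hc]

lemma weil_mkP_zero (ψ : AddChar F k) [Fact (ψ ≠ 1)] (a b d : F) (h) (φ : Vp F k) :
    (weil ψ (mkP a b 0 d h) φ).1 = opU ψ (a * b) (opT a φ.1) := by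
  rw [mkP, weil_coe, om]
  simp

lemma ev0_weil (ψ : AddChar F k) [Fact (ψ ≠ 1)] (g : PG F) (φ : Vp F k) :
    ev0 F k (weil ψ g φ) = ev0 F k φ := by
  refine PG_ind (fun g => ev0 F k (weil ψ g φ) = ev0 F k φ) (fun a b c d h => ?_) g
  rw [ev0_apply, ev0_apply, mkP, weil_coe, om_zero ψ _ φ.2]

theorem uniq (ρ : PG F →* (X →ₗ[k] X)) (hdim : finrank k X = (SS F).card)
    (irr : ∀ p : Submodule k X, (∀ g, ∀ x ∈ p, ρ g x ∈ p) → p = ⊥ ∨ p = ⊤)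
    (ψ₀ : AddChar F k) [hψ : Fact (ψ₀ ≠ 1)] :
    ∃ (ψ : AddChar F k) (_ : Fact (ψ ≠ 1)) (Φ : X →ₗ[k] Vp F k), Function.Injective Φ ∧
      LinearMap.range Φ = LinearMap.ker (ev0 F k) ∧ ∀ g m, Φ (ρ g m) = weil ψ g (Φ m) := by
  obtain ⟨ψ, hψ1, v, hv, hu⟩ := exists_psi ρ hdim irr ψ₀
  have : Fact (ψ ≠ 1) := ⟨hψ1⟩
  obtain ⟨Φ, h1, h2, h3, h4, h5⟩ := uniq_aux hv hu hdim
  refine ⟨ψ, this, Φ, h1, h2, fun g m => ?_⟩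
  refine PG_ind (fun g => Φ (ρ g m) = weil ψ g (Φ m)) (fun a b c d h => ?_) g
  apply Subtype.ext
  by_cases hc : c = 0
  · subst hc
    have ha : a ≠ 0 := by rintro rfl; simp at h
    rw [weil_mkP_zero, mkP_dec0, rmul, h3, h4 _ ha]
  · rw [weil_mkP_ne _ _ _ _ _ _ hc, mkP_dec _ _ _ _ _ hc, rmul, rmul, rmul, h3,
      h4 _ (one_div_ne_zero hc), h5, h3]

/-- the sequence -/
theorem exists_seq (ρ : PG F →* (X →ₗ[k] X)) (hdim : finrank k X = (SS F).card)
    (irr : ∀ p : Submodule k X, (∀ g, ∀ x ∈ p, ρ g x ∈ p) → p = ⊥ ∨ p = ⊤)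
    (ψ₀ : AddChar F k) [hψ : Fact (ψ₀ ≠ 1)] :
    ∃ (a b : PG F) (haa : a * a = 1) (hbb : b * b = 1) (hba : b * a = a * b)
      (PP : V4 k (Vp F k)), PP.Hig ∧ Nonempty (V4.Seq (repV4 ρ a b haa hbb hba) PP (V4.triv k)) := by
  obtain ⟨ψ, hψ1, Φ, h1, h2, h3⟩ := uniq ρ hdim irr ψ₀
  obtain ⟨m, n, h, hn, hH⟩ := exists_hig ψ
  refine ⟨wP F, bP m n h, wP_sq, bP_sq m n h, bP_wP m n h, VV ψ m n h, hH, ⟨?_⟩⟩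
  exact ⟨Φ, ev0 F k, h1, ev0_surj, h2, ⟨fun x => h3 _ x, fun x => h3 _ x⟩,
    ⟨fun x => ev0_weil ψ _ x, fun x => ev0_weil ψ _ x⟩⟩

/-- irreducibility of the Weil piece -/
theorem weil_irr (ψ : AddChar F k) [hψ : Fact (ψ ≠ 1)] (p : Submodule k (Vp F k))
    (hp : ∀ g, ∀ x ∈ p, weil ψ g x ∈ p) (hle : p ≤ LinearMap.ker (ev0 F k)) :
    p = ⊥ ∨ p = LinearMap.ker (ev0 F k) := by
  by_cases hb : p = ⊥
  · exact Or.inl hb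
  right
  refine le_antisymm hle ?_
  obtain ⟨φ, hφ, hφ0⟩ := Submodule.exists_mem_ne_zero_of_ne_bot hb
  have hφz : φ.1 0 = 0 := hle hφ
  let D : F → Vp F k := fun s => ⟨Pi.single s 1 + Pi.single (-s) 1, fun y => by
    simp only [Pi.add_apply, Pi.single_apply]
    rw [add_comm]; simp only [neg_eq_iff_eq_neg, neg_neg]⟩
  have hdec : ∀ φ : Vp F k, φ.1 0 = 0 → φ = ∑ s ∈ SS F, φ.1 s • D s := by
    intro φ h0
    apply Subtype.ext
    have := Vp_decomp φ.2
    rw [h0, zero_smul, zero_add] at this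
    rw [Submodule.coe_sum]
    exact this
  obtain ⟨s, hs, hs0⟩ : ∃ s ∈ SS F, φ.1 s ≠ 0 := by
    by_contra! hcon
    apply hφ0
    rw [hdec φ hφz]
    exact sum_eq_zero fun s hs => by rw [hcon s hs, zero_smul]
  have hsn := (mem_SS.1 hs).1
  have h1 : D s ∈ p := by
    have h2 : ∑ x, ψ (-(x * s ^ 2)) • weil ψ (uP x) φ ∈ p :=
      Submodule.sum_mem _ fun x _ => p.smul_mem _ (hp _ _ hφ)
    have h3 : ∑ x, ψ (-(x * s ^ 2)) • weil ψ (uP x) φ = φ.1 s • D s := by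
      apply Subtype.ext
      rw [Submodule.coe_sum]
      ext y
      simp only [Finset.sum_apply, Submodule.coe_smul, Pi.smul_apply, uP, weil_mkP_zero, opU_apply,
        opT_apply, one_mul, smul_eq_mul, D]
      have : ∀ x, ψ (-(x * s ^ 2)) * (ψ (x * y ^ 2) * φ.1 y) = ψ (x * (y ^ 2 - s ^ 2)) * φ.1 y := by
        intro x
        rw [← mul_assoc, ← AddChar.map_add_eq_mul]; congr 2; ring
      simp_rw [this]
      rw [← sum_mul, sum_psi, Pi.add_apply, Pi.single_apply, Pi.single_apply]
      have hss : s ≠ -s := fun h => (neg_mem_SS hsn).1 (h ▸ hs) hs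
      by_cases e1 : y = s
      · subst e1; simp [hss]
      · by_cases e2 : y = -s
        · subst e2; simp [hss.symm, φ.2 s]
        · rw [if_neg, if_neg e1, if_neg e2]
          · simp
          · intro h
            rcases sq_eq_sq_iff_eq_or_eq_neg.1 (sub_eq_zero.1 h) with h | h
            · exact e1 h
            · exact e2 h
    rw [h3] at h2
    exact (Submodule.smul_mem_iff _ hs0).1 h2
  have h2 : ∀ z ∈ SS F, D z ∈ p := by
    intro z hz
    have hz0 := (mem_SS.1 hz).1
    have h4 := hp (mkP (s / z) 0 0 (z / s) (by field_simp; simp)) _ h1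
    convert h4 using 1
    apply Subtype.ext
    rw [weil_mkP_zero]
    ext y
    simp only [D, opU_apply, opT_apply, mul_zero, zero_mul, AddChar.map_zero_eq_one, one_mul,
      Pi.add_apply, Pi.single_apply]
    have e1 : s / z * y = s ↔ y = z := by
      rw [div_mul_eq_mul_div, div_eq_iff hz0, mul_right_inj' hsn]
    have e2 : s / z * y = -s ↔ y = -z := by
      rw [div_mul_eq_mul_div, div_eq_iff hz0, neg_mul, ← mul_neg, mul_right_inj' hsn]
    simp only [e1, e2]
  intro χ hχ
  rw [hdec χ hχ]
  exact Submodule.sum_mem _ fun z hz => p.smul_mem _ (h2 z hz)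

end uniq
end PSLNA


open CategoryTheory CategoryTheory.MonoidalCategory

namespace PSLNA

set_option linter.unusedSectionVars false
set_option linter.unusedDecidableInType false

open Module

section fd
variable {k G : Type} [Field k] [Monoid G]

/-- underlying linear map -/
def lin {V W : FDRep k G} (f : V ⟶ W) : V →ₗ[k] W := f.hom.hom.hom

lemma lin_comm {V W : FDRep k G} (f : V ⟶ W) (g : G) (v : V) :
    lin f (V.ρ g v) = W.ρ g (lin f v) :=
  ConcreteCategory.congr_hom ((forget (FGModuleCat k)).congr_map (f.comm g)) v

lemma lin_ext {V W : FDRep k G} {f f' : V ⟶ W} (h : ∀ v, lin f v = lin f' v) : f = f' := by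
  apply Action.Hom.ext
  apply InducedCategory.hom_ext
  apply ModuleCat.hom_ext
  exact LinearMap.ext h

def mkHom {V W : FDRep k G} (f : V →ₗ[k] W) (h : ∀ g v, f (V.ρ g v) = W.ρ g (f v)) : V ⟶ W :=
  ⟨InducedCategory.homMk (ModuleCat.ofHom f), fun g ↦ by
    ext1
    exact LinearMap.ext (h g)⟩

lemma lin_mkHom {V W : FDRep k G} (f : V →ₗ[k] W) (h : ∀ g v, f (V.ρ g v) = W.ρ g (f v)) :
    lin (mkHom f h) = f := rfl

lemma lin_comp {V W U : FDRep k G} (f : V ⟶ W) (f' : W ⟶ U) (v : V) :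
    lin (f ≫ f') v = lin f' (lin f v) := rfl

lemma lin_id {V : FDRep k G} (v : V) : lin (𝟙 V) v = v := rfl

lemma lin_zero {V W : FDRep k G} (v : V) : lin (0 : V ⟶ W) v = 0 := rfl

lemma tensor_rho (V W : FDRep k G) (g : G) :
    (V ⊗ W).ρ g = TensorProduct.map (V.ρ g) (W.ρ g) := rfl

lemma tensor_repV4 (V W : FDRep k G) (a b : G) (haa : a * a = 1) (hbb : b * b = 1)
    (hba : b * a = a * b) :
    repV4 (V ⊗ W).ρ a b haa hbb hba =
    (V4.tensor (repV4 V.ρ a b haa hbb hba) (repV4 W.ρ a b haa hbb hba) : V4 k (TensorProduct k V W)) := rfl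

end fd
end PSLNA


open CategoryTheory CategoryTheory.MonoidalCategory

namespace PSLNA

set_option linter.unusedSectionVars false
set_option linter.unusedDecidableInType false

open Module

section fd
variable {k G : Type} [Field k] [Monoid G]

/-- subrepresentation -/
def subRho {X : Type} [AddCommGroup X] [Module k X] (ρ : G →* (X →ₗ[k] X)) (p : Submodule k X)
    (hp : ∀ g, ∀ x ∈ p, ρ g x ∈ p) : G →* (p →ₗ[k] p) where
  toFun g := (ρ g).restrict (hp g)
  map_one' := by ext x; simp
  map_mul' g h := by ext x; simp

noncomputable def subRep (V : FDRep k G) (p : Submodule k V) (hp : ∀ g, ∀ x ∈ p, V.ρ g x ∈ p) : FDRep k G :=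
  FDRep.of (subRho V.ρ p hp)

noncomputable def subIncl (V : FDRep k G) (p : Submodule k V) (hp : ∀ g, ∀ x ∈ p, V.ρ g x ∈ p) :
    subRep V p hp ⟶ V :=
  mkHom (V := subRep V p hp) (W := V) p.subtype (fun _ _ => rfl)

lemma subIncl_apply (V : FDRep k G) (p : Submodule k V) (hp : ∀ g, ∀ x ∈ p, V.ρ g x ∈ p) (x : p) :
    lin (subIncl V p hp) x = x.1 := rfl

lemma mono_of_inj {V W : FDRep k G} (f : V ⟶ W) (h : Function.Injective (lin f)) : Mono f := by
  constructor
  intro Z g g' hg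
  apply lin_ext
  intro z
  apply h
  have := congrArg (fun t => lin t z) hg
  exact this

lemma inj_of_mono {V W : FDRep k G} (f : V ⟶ W) [Mono f] : Function.Injective (lin f) := by
  rw [injective_iff_map_eq_zero]
  intro x hx
  have hp : ∀ g, ∀ x ∈ LinearMap.ker (lin f), V.ρ g x ∈ LinearMap.ker (lin f) := by
    intro g x hx
    rw [LinearMap.mem_ker] at *
    rw [lin_comm, hx, map_zero]
  have h1 : subIncl V _ hp ≫ f = 0 ≫ f := by
    apply lin_ext
    intro v
    rw [lin_comp, lin_comp, lin_zero, map_zero]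
    exact v.2
  have h2 := (cancel_mono f).1 h1
  have h3 := congrArg (fun t => lin t (⟨x, hx⟩ : LinearMap.ker (lin f))) h2
  exact h3

lemma bij_of_iso {V W : FDRep k G} (f : V ⟶ W) [IsIso f] : Function.Bijective (lin f) := by
  refine Function.bijective_iff_has_inverse.2 ⟨lin (inv f), fun x => ?_, fun x => ?_⟩
  · rw [← lin_comp, IsIso.hom_inv_id, lin_id]
  · rw [← lin_comp, IsIso.inv_hom_id, lin_id]

lemma iso_of_bij {V W : FDRep k G} (f : V ⟶ W) (h : Function.Bijective (lin f)) : IsIso f := by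
  let e := LinearEquiv.ofBijective (lin f) h
  have he : ∀ x, e x = lin f x := fun x => rfl
  refine ⟨mkHom (V := W) (W := V) e.symm.toLinearMap ?_, ?_, ?_⟩
  · intro g v
    apply e.injective
    rw [he (V.ρ g _), lin_comm]
    change e (e.symm _) = W.ρ g (e (e.symm v))
    rw [e.apply_symm_apply, e.apply_symm_apply]
  · apply lin_ext; intro v
    rw [lin_comp, lin_mkHom, lin_id]
    exact e.symm_apply_apply v
  · apply lin_ext; intro v
    rw [lin_comp, lin_mkHom, lin_id]
    exact e.apply_symm_apply v

lemma simple_irr (M : FDRep k G) (hM : Simple M) (p : Submodule k M)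
    (hp : ∀ g, ∀ x ∈ p, M.ρ g x ∈ p) : p = ⊥ ∨ p = ⊤ := by
  have hm : Mono (subIncl M p hp) := mono_of_inj _ Subtype.val_injective
  by_cases h : p = ⊥
  · exact Or.inl h
  right
  have hi : IsIso (subIncl M p hp) := by
    apply isIso_of_mono_of_nonzero
    intro h0
    obtain ⟨x, hx, hx0⟩ := Submodule.exists_mem_ne_zero_of_ne_bot h
    have := congrArg (fun t => lin t (⟨x, hx⟩ : p)) h0
    exact hx0 this
  rw [eq_top_iff]
  intro x _
  obtain ⟨y, hy⟩ := (bij_of_iso (subIncl M p hp)).2 x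
  rw [← hy]
  exact y.2

lemma irr_simple (M : FDRep k G) (hnt : ∃ x : M, x ≠ 0)
    (irr : ∀ p : Submodule k M, (∀ g, ∀ x ∈ p, M.ρ g x ∈ p) → p = ⊥ ∨ p = ⊤) : Simple M := by
  constructor
  intro Y f hf
  constructor
  · intro hi h0
    obtain ⟨x, hx⟩ := hnt
    obtain ⟨y, hy⟩ := (bij_of_iso f).2 x
    rw [h0] at hy
    exact hx hy.symm
  · intro h0
    apply iso_of_bij
    refine ⟨inj_of_mono f, ?_⟩
    rw [← LinearMap.range_eq_top]
    refine (irr _ ?_).resolve_left ?_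
    · rintro g _ ⟨x, rfl⟩
      exact ⟨Y.ρ g x, lin_comm f g x⟩
    · intro h
      apply h0
      apply lin_ext
      intro v
      have : lin f v ∈ (⊥ : Submodule k M) := h ▸ ⟨v, rfl⟩
      exact this

open AlgebraicModule

theorem summand_aux [CharP k 2] (T : FDRep k G) (a b : G) (haa : a * a = 1) (hbb : b * b = 1)
    (hba : b * a = a * b) (hE : (repV4 T.ρ a b haa hbb hba).StEnd) (n : ℕ) (hn : 0 < n)
    (hG : (repV4 T.ρ a b haa hbb hba).Grow n) :
    ∃ N : FDRep k G, AlgebraicModule.Indecomposable N ∧ IsSummand N T ∧ n ≤ finrank k N := by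
  classical
  set P := repV4 T.ρ a b haa hbb hba with hP
  let Q : ℕ → Prop := fun r => ∃ e : T →ₗ[k] T, (∀ g x, e (T.ρ g x) = T.ρ g (e x)) ∧
    (∀ x, e (e x) = e x) ∧ (¬ ∃ f, e = V4.tr P P f) ∧ finrank k (LinearMap.range e) = r
  have hex : ∃ r, Q r := by
    refine ⟨_, LinearMap.id, fun _ _ => rfl, fun _ => rfl, ?_, rfl⟩
    rintro ⟨f, hf⟩
    have h1 : P.Hig := ⟨f, hf.symm⟩
    have h2 := h1.finrank_eq
    have h3 := hG.1
    omega
  obtain ⟨e, heq, hee, hnt, hr⟩ := Nat.find_spec hex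
  have hmin : ∀ e' : T →ₗ[k] T, (∀ g x, e' (T.ρ g x) = T.ρ g (e' x)) →
      (∀ x, e' (e' x) = e' x) → (¬ ∃ f, e' = V4.tr P P f) →
      finrank k (LinearMap.range e) ≤ finrank k (LinearMap.range e') := by
    intro e' h1 h2 h3
    rw [hr]
    exact Nat.find_min' hex ⟨e', h1, h2, h3, rfl⟩
  have hrank := V4.idem_rank P hE e ⟨fun x => heq a x, fun x => heq b x⟩ hee hnt
  have hnr : n ≤ finrank k (LinearMap.range e) := by
    have := hG.1
    omega
  have hp : ∀ g, ∀ x ∈ LinearMap.range e, T.ρ g x ∈ LinearMap.range e := by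
    rintro g _ ⟨x, rfl⟩
    exact ⟨T.ρ g x, heq g x⟩
  let N := subRep T (LinearMap.range e) hp
  let σ : G →* (LinearMap.range e →ₗ[k] LinearMap.range e) := subRho T.ρ (LinearMap.range e) hp
  let r : T →ₗ[k] LinearMap.range e := e.rangeRestrict
  have hrx : ∀ x : LinearMap.range e, r x.1 = x := by
    rintro ⟨_, ⟨x, rfl⟩⟩
    exact Subtype.ext (hee x)
  have hrρ : ∀ g x, r (T.ρ g x) = σ g (r x) := fun g x => Subtype.ext (heq g x)
  refine ⟨N, ⟨?_, ?_⟩, ⟨subIncl T _ hp, mkHom (V := T) (W := N) r hrρ, ?_⟩, hnr⟩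
  · intro hz
    have h0 : 𝟙 N = 0 := hz.eq_of_src _ _
    have h1 : ∀ x : LinearMap.range e, x = 0 := fun x => by
      have h2 := congrArg (fun t : N ⟶ N => (lin t : N →ₗ[k] N) x) h0
      exact h2
    have : Subsingleton (LinearMap.range e) := ⟨fun x y => by rw [h1 x, h1 y]⟩
    have := Module.finrank_zero_of_subsingleton (R := k) (M := LinearMap.range e)
    omega
  · intro e' he'
    let E : LinearMap.range e →ₗ[k] LinearMap.range e := lin e'
    have hEE : ∀ x, E (E x) = E x := fun x => congrArg (fun t => lin t x) he'
    have hEρ : ∀ g (x : LinearMap.range e), E (σ g x) = σ g (E x) := fun g x => lin_comm e' g x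
    -- a general statement about idempotents of the image
    have gen : ∀ E : LinearMap.range e →ₗ[k] LinearMap.range e, (∀ x, E (E x) = E x) →
        (∀ g (x : LinearMap.range e), E (σ g x) = σ g (E x)) →
        (¬ ∃ f, (LinearMap.range e).subtype ∘ₗ E ∘ₗ r = V4.tr P P f) → ∀ x, E x = x := by
      intro E hEE hEρ hnt' x
      have h1 := hmin ((LinearMap.range e).subtype ∘ₗ E ∘ₗ r) (fun g x => by
        simp only [LinearMap.comp_apply]
        rw [hrρ, hEρ]; rfl) (fun x => by
        simp only [LinearMap.comp_apply, Submodule.subtype_apply]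
        rw [hrx, hEE]) hnt'
      have h2 : LinearMap.range ((LinearMap.range e).subtype ∘ₗ E ∘ₗ r) ≤ LinearMap.range e := by
        rintro _ ⟨y, rfl⟩
        exact (E (r y)).2
      have h3 := Submodule.eq_of_le_of_finrank_le h2 h1
      have h4 : x.1 ∈ LinearMap.range ((LinearMap.range e).subtype ∘ₗ E ∘ₗ r) := by
        rw [h3]; exact x.2
      obtain ⟨y, hy⟩ := h4
      have h5 : E (r y) = x := Subtype.ext hy
      rw [← h5, hEE]
    by_cases hc : ∃ f, (LinearMap.range e).subtype ∘ₗ E ∘ₗ r = V4.tr P P f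
    · left
      obtain ⟨f, hf⟩ := hc
      have := gen (LinearMap.id - E) (fun x => by simp [hEE]) (fun g x => by
        rw [LinearMap.sub_apply, LinearMap.sub_apply, LinearMap.id_apply, LinearMap.id_apply, hEρ,
          map_sub]) (by
        rintro ⟨f', hf'⟩
        apply hnt
        refine ⟨f + f', ?_⟩
        rw [V4.tr_add, ← hf, ← hf']
        ext x
        simp [r])
      have h7 : ∀ x : LinearMap.range e, E x = 0 := by
        intro x
        have h6 := this x
        rwa [LinearMap.sub_apply, LinearMap.id_apply, sub_eq_self] at h6
      apply lin_ext
      intro v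
      exact h7 v
    · right
      apply lin_ext
      intro v
      exact gen E hEE hEρ hc v
  · apply lin_ext
    intro x
    exact hrx x

/-- main non-algebraicity criterion -/
theorem nonalg [CharP k 2] (M : FDRep k G) (a b : G) (haa : a * a = 1) (hbb : b * b = 1)
    (hba : b * a = a * b) {Y : Type} [AddCommGroup Y] [Module k Y] [FiniteDimensional k Y]
    (PP : V4 k Y) (hH : PP.Hig) (S : V4.Seq (repV4 M.ρ a b haa hbb hba) PP (V4.triv k)) :
    ¬ IsAlgebraic M := by
  have key : ∀ n, (repV4 (tensorPow M n).ρ a b haa hbb hba).StEnd ∧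
      (repV4 (tensorPow M n).ρ a b haa hbb hba).Grow (2 * n + 3) := by
    intro n
    induction n with
    | zero => exact ⟨S.stEnd hH V4.triv_stEnd, S.grow hH 1 V4.triv_grow⟩
    | succ n ih =>
      change (repV4 (tensorPow M n ⊗ M).ρ a b haa hbb hba).StEnd ∧
        (repV4 (tensorPow M n ⊗ M).ρ a b haa hbb hba).Grow (2 * (n + 1) + 3)
      obtain ⟨S'⟩ := V4.Seq.tensor (repV4 (tensorPow M n).ρ a b haa hbb hba) S
      have hH' := V4.Hig.tensor (repV4 (tensorPow M n).ρ a b haa hbb hba) hH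
      have h1 := S'.stEnd hH' ih.1
      have h2 := S'.grow hH' _ ih.2
      exact ⟨h1, h2⟩
  rintro ⟨L, hL⟩
  obtain ⟨D, hD⟩ : ∃ D : ℕ, ∀ N ∈ L, finrank k N ≤ D := by
    refine ⟨(L.map fun N : FDRep k G => finrank k N).sum, fun N hN => ?_⟩
    exact List.le_sum_of_mem (List.mem_map_of_mem hN)
  obtain ⟨N, h1, h2, h3⟩ := summand_aux (tensorPow M D) a b haa hbb hba (key D).1 _ (by omega) (key D).2
  obtain ⟨N', hN', ⟨i⟩⟩ := hL N h1 ⟨D, h2⟩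
  have h4 := (FDRep.isoToLinearEquiv i).finrank_eq
  have h5 := hD N' hN'
  omega

end fd
end PSLNA


open CategoryTheory CategoryTheory.MonoidalCategory

namespace PSLNA
open Module

theorem exists_char (F k : Type) [Field F] [Finite F] [Field k] [IsAlgClosed k]
    (h : ringChar k ≠ ringChar F) : ∃ ψ : AddChar F k, ψ ≠ 1 := by
  let P := AddChar.FiniteField.primitiveChar F k h
  have hP : P.char ≠ 1 := by
    have := P.prim one_ne_zero
    rwa [AddChar.mulShift_one] at this
  let f : CyclotomicField P.n k →+* k :=
    (Polynomial.SplittingField.lift (Polynomial.cyclotomic P.n k)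
      (IsAlgClosed.splits ((Polynomial.cyclotomic P.n k).map (algebraMap k k)))).toRingHom
  refine ⟨(f : CyclotomicField P.n k →* k).compAddChar P.char, ?_⟩
  obtain ⟨x, hx⟩ := AddChar.ne_one_iff.1 hP
  refine AddChar.ne_one_iff.2 ⟨x, fun h => hx ?_⟩
  apply f.injective
  rw [map_one]
  exact h

theorem main {F k : Type} [Field F] [Fintype F] [DecidableEq F] [Fact (Fintype.card F % 8 = 7)]
    [Field k] [CharP k 2] [IsAlgClosed k] (q : ℕ) (hq : Fintype.card F = q) :
    (∃ M : FDRep k (PSL 2 F),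
        Simple M ∧ Module.finrank k M = (q - 1) / 2) ∧
      ∀ M : FDRep k (PSL 2 F), Simple M →
        Module.finrank k M = (q - 1) / 2 → ¬ AlgebraicModule.IsAlgebraic M := by
  have h7 : Fintype.card F % 8 = 7 := Fact.out
  have hc := card_SS (F := F)
  have hq' : (q - 1) / 2 = (SS F).card := by omega
  rw [hq']
  have hch : ringChar k ≠ ringChar F := by
    rw [ringChar.eq k 2]
    intro h
    have h2 : ringChar F ∣ Fintype.card F :=
      (ringChar.spec F _).1 (by exact Nat.cast_card_eq_zero F)
    rw [← h] at h2
    omega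
  obtain ⟨ψ₀, hψ⟩ := exists_char F k hch
  have : Fact (ψ₀ ≠ 1) := ⟨hψ⟩
  refine ⟨?_, ?_⟩
  · have stab : ∀ g, ∀ x ∈ LinearMap.ker (ev0 F k), weil ψ₀ g x ∈ LinearMap.ker (ev0 F k) := by
      intro g x hx
      rw [LinearMap.mem_ker] at *
      rw [ev0_weil, hx]
    let σ : PSL 2 F →* _ := subRho (weil ψ₀) (LinearMap.ker (ev0 F k)) stab
    have hfin := finrank_ker_ev0 (F := F) (k := k)
    let M : FDRep k (PSL 2 F) := FDRep.of (V := LinearMap.ker (ev0 F k)) σ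
    refine ⟨M, irr_simple M ?_ ?_, hfin⟩
    · have : Nontrivial (LinearMap.ker (ev0 F k)) := by
        apply Module.nontrivial_of_finrank_pos (R := k)
        omega
      obtain ⟨x, hx⟩ := exists_ne (0 : LinearMap.ker (ev0 F k))
      exact ⟨x, hx⟩
    · have key : ∀ p : Submodule k (LinearMap.ker (ev0 F k)), (∀ g, ∀ x ∈ p, σ g x ∈ p) →
          p = ⊥ ∨ p = ⊤ := by
        intro p hp
        have h1 := weil_irr ψ₀ (p.map (LinearMap.ker (ev0 F k)).subtype) (by
          rintro g _ ⟨x, hx, rfl⟩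
          exact ⟨σ g x, hp g x hx, rfl⟩) (Submodule.map_subtype_le _ _)
        rcases h1 with h1 | h1
        · left
          apply Submodule.map_injective_of_injective (Submodule.subtype_injective (LinearMap.ker (ev0 F k)))
          rw [h1, Submodule.map_bot]
        · right
          apply Submodule.map_injective_of_injective (Submodule.subtype_injective (LinearMap.ker (ev0 F k)))
          rw [h1, Submodule.map_subtype_top]
      exact key
  · intro M hM hd
    obtain ⟨a, b, haa, hbb, hba, PP, hH, ⟨S⟩⟩ :=
      exists_seq M.ρ hd (fun p hp => simple_irr M hM p hp) ψ₀
    exact nonalg M a b haa hbb hba PP hH S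

end PSLNA

theorem psl2_half_dimensional_nonalgebraic (p s : ℕ) [Fact p.Prime] (hs : 1 ≤ s)
    (hq : p ^ s % 8 = 7)
    (k : Type) [Field k] [IsAlgClosed k] (hk : CharP k 2) :
    (∃ M : FDRep k (PSL 2 (GaloisField p s)),
        Simple M ∧ Module.finrank k M = (p ^ s - 1) / 2) ∧
      ∀ M : FDRep k (PSL 2 (GaloisField p s)), Simple M →
        Module.finrank k M = (p ^ s - 1) / 2 → ¬ AlgebraicModule.IsAlgebraic M := by
  classical
  have : Fintype (GaloisField p s) := Fintype.ofFinite _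
  have hc : Fintype.card (GaloisField p s) = p ^ s := by
    rw [← Nat.card_eq_fintype_card]
    exact GaloisField.card p s (by omega)
  have : Fact (Fintype.card (GaloisField p s) % 8 = 7) := ⟨by rw [hc, hq]⟩
  exact PSLNA.main (p ^ s) hc
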